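/- arXiv:1901.09180 — 12 statements merged into one kernel-verified Lean document; each statement's English description precedes it below -/
import Mathlib

section
/- Let (W,R) be a finite directed graph. There exists a non-empty semi-kernel of (W,R) if and only if the proponent P has a winning strategy in the Poison Game played on (W,R). -/
/-- `X` is an independent set of the directed graph `(W,R)`. -/
def Independent {W : Type} (R : W → W → Prop) (X : Set W) : Prop :=
  ∀ x ∈ X, ∀ y ∈ X, ¬ R x y

/-- `X` is a semi-kernel of `(W,R)`: it is independent, and every `R`-successor
`y` of a point of `X` has in turn an `R`-successor in `X`. -/
def SemiKernel {W : Type} (R : W → W → Prop) (X : Set W) : Prop :=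
  Independent R X ∧ ∀ x ∈ X, ∀ y, R x y → ∃ z ∈ X, R y z

/-- Positions of the Poison Game on `(W,R)` arising from play consistent with a
(history-based) strategy `σ` for the proponent P.  `GPos R σ h Pois b` holds when
`h` is a legal history of moves (most recent move first, P moved first), `Pois`
is the set of nodes poisoned so far by the opponent O, and `b = true` iff it is
P's turn to move (i.e. the history ends with a move of O).  P's moves are the
ones prescribed by `σ` (including the initial choice `σ []`); O may move to any
`R`-successor of the current node, poisoning it; P may only move to an
`R`-successor that has not been poisoned. -/
inductive GPos {W : Type} (R : W → W → Prop) (σ : List W → W) :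
    List W → Set W → Bool → Prop
  | init : GPos R σ [σ []] ∅ false
  | omove {h : List W} {Pois : Set W} {w v : W} :
      GPos R σ (w :: h) Pois false → R w v →
      GPos R σ (v :: w :: h) (insert v Pois) true
  | pmove {h : List W} {Pois : Set W} {w : W} :
      GPos R σ (w :: h) Pois true → R w (σ (w :: h)) → σ (w :: h) ∉ Pois →
      GPos R σ (σ (w :: h) :: w :: h) Pois false

/-- `σ` is a winning strategy for the proponent P in the Poison Game on `(W,R)`:
whenever it is P's turn in a play consistent with `σ`, the move prescribed by
`σ` is legal (an `R`-successor of the current node that is not poisoned).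
Since O wins exactly the plays in which P gets stuck at her turn, and all
infinite plays are won by P, this says precisely that P never loses a play
when following `σ`. -/
def WinningStrategy {W : Type} (R : W → W → Prop) (σ : List W → W) : Prop :=
  ∀ (h : List W) (Pois : Set W) (w : W),
    GPos R σ (w :: h) Pois true → R w (σ (w :: h)) ∧ σ (w :: h) ∉ Pois

theorem gpos_false_notMem {W : Type} {R : W → W → Prop} {σ : List W → W} {l : List W}
    {P : Set W} {b : Bool} (hg : GPos R σ l P b) :
    b = false → ∀ w h, l = w :: h → w ∉ P := by
  intro hb w h hl
  cases hg with
  | init => simp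
  | omove _ _ => simp at hb
  | pmove _ _ h3 =>
    simp only [List.cons.injEq] at hl
    rw [← hl.1]
    exact h3

theorem gpos_semikernel {W : Type} {R : W → W → Prop} {X : Set W} (hX : SemiKernel R X)
    {σ : List W → W} (h0 : σ [] ∈ X)
    (hσ : ∀ w h, (∃ z ∈ X, R w z) → σ (w :: h) ∈ X ∧ R w (σ (w :: h)))
    {l : List W} {P : Set W} {b : Bool} (hg : GPos R σ l P b) :
    (∀ p ∈ P, p ∉ X) ∧ ∀ w h, l = w :: h →
      (b = false → w ∈ X) ∧ (b = true → ∃ z ∈ X, R w z) := by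
  induction hg with
  | init =>
    refine ⟨by simp, ?_⟩
    intro w h hl
    simp only [List.cons.injEq] at hl
    refine ⟨fun _ => hl.1 ▸ h0, by simp⟩
  | @omove h P w v _ hr ih =>
    have hw : w ∈ X := (ih.2 w h rfl).1 rfl
    refine ⟨?_, ?_⟩
    · intro p hp hpX
      rcases hp with rfl | hp
      · exact hX.1 w hw p hpX hr
      · exact ih.1 p hp hpX
    · intro w' h' hl
      simp only [List.cons.injEq] at hl
      obtain ⟨rfl, _⟩ := hl
      exact ⟨by simp, fun _ => hX.2 w hw v hr⟩
  | @pmove h P w _ _ _ ih =>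
    refine ⟨ih.1, ?_⟩
    intro w' h' hl
    simp only [List.cons.injEq] at hl
    refine ⟨fun _ => hl.1 ▸ (hσ w h ((ih.2 w h rfl).2 rfl)).1, by simp⟩

/-- Duchet–Meyniel: in a finite directed graph `(W,R)` there is a
non-empty semi-kernel iff the proponent P has a winning strategy in the Poison
Game on `(W,R)`. -/
theorem stmt_0 {W : Type} [Finite W] (R : W → W → Prop) :
    (∃ X : Set W, X.Nonempty ∧ SemiKernel R X) ↔
      (∃ σ : List W → W, WinningStrategy R σ) := by
  constructor
  · rintro ⟨X, ⟨x0, hx0⟩, hX⟩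
    classical
    let σ : List W → W := fun l => match l with
      | [] => x0
      | w :: _ => if hw : ∃ z ∈ X, R w z then hw.choose else x0
    have hσ : ∀ w h, (∃ z ∈ X, R w z) → σ (w :: h) ∈ X ∧ R w (σ (w :: h)) := by
      intro w h hw
      have e : σ (w :: h) = hw.choose := dif_pos hw
      rw [e]
      exact hw.choose_spec
    refine ⟨σ, fun h P w hg => ?_⟩
    obtain ⟨h1, h2⟩ := gpos_semikernel hX (σ := σ) hx0 hσ hg
    obtain ⟨h3, h4⟩ := hσ w h ((h2 w h rfl).2 rfl)
    exact ⟨h4, fun hp => h1 _ hp h3⟩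
  · rintro ⟨σ, hσ⟩
    have hne : {M : Set W | ∃ w h, GPos R σ (w :: h) M false}.Nonempty :=
      ⟨∅, σ [], [], GPos.init⟩
    obtain ⟨M, hM⟩ := (Set.toFinite {M : Set W | ∃ w h, GPos R σ (w :: h) M false}).exists_maximal hne
    have key : ∀ x h y, GPos R σ (x :: h) M false → R x y →
        y ∈ M ∧ ∃ z, R y z ∧ ∃ h', GPos R σ (z :: h') M false := by
      intro x h y hg hr
      have g1 := GPos.omove hg hr
      obtain ⟨a, b⟩ := hσ _ _ _ g1
      have g2 := GPos.pmove g1 a b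
      have hy : y ∈ M := hM.2 ⟨_, _, g2⟩ (Set.subset_insert y M) (Set.mem_insert y M)
      rw [Set.insert_eq_of_mem hy] at g2
      exact ⟨hy, _, a, _, g2⟩
    obtain ⟨w, h, hg⟩ := hM.1
    refine ⟨{x | ∃ h, GPos R σ (x :: h) M false}, ⟨w, h, hg⟩, ?_, ?_⟩
    · rintro x ⟨hx, gx⟩ y ⟨hy, gy⟩ hr
      exact gpos_false_notMem gy rfl _ _ rfl (key x hx y gx hr).1
    · rintro x ⟨hx, gx⟩ y hr
      obtain ⟨_, z, hz, hz'⟩ := key x hx y gx hr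
      exact ⟨z, hz', hz⟩
end

section
/- For every formula φ of the poison modal language, the formula □𝔭 → (■φ ↔ □φ) is PML-valid. -/
/-- Formulas of the poison modal language `L^𝔭` over a set `A` of
propositional atoms, with the distinguished poison atom `𝔭`. -/
inductive PForm (A : Type) : Type
  | atom : A → PForm A
  | poison : PForm A
  | neg : PForm A → PForm A
  | conj : PForm A → PForm A → PForm A
  | dia : PForm A → PForm A
  | pdia : PForm A → PForm A

namespace PForm

def bot {A : Type} : PForm A := conj poison (neg poison)
def top {A : Type} : PForm A := neg bot
def disj {A : Type} (φ ψ : PForm A) : PForm A := neg (conj (neg φ) (neg ψ))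
def impl {A : Type} (φ ψ : PForm A) : PForm A := neg (conj φ (neg ψ))
def iffF {A : Type} (φ ψ : PForm A) : PForm A := conj (impl φ ψ) (impl ψ φ)
def box {A : Type} (φ : PForm A) : PForm A := neg (dia (neg φ))
def pbox {A : Type} (φ : PForm A) : PForm A := neg (pdia (neg φ))

end PForm

/-- Satisfaction for poison modal logic.  A Kripke model `M = (W,R,V)` is given
by `R`, the valuation `V` on the ordinary atoms, and the current valuation
`Vp ⊆ W` of the poison atom `𝔭` (the model `M•_v` is obtained by replacing
`Vp` with `insert v Vp`). -/
def Sat {A W : Type} (R : W → W → Prop) (V : A → Set W) :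
    PForm A → Set W → W → Prop
  | .atom a, _, w => w ∈ V a
  | .poison, Vp, w => w ∈ Vp
  | .neg φ, Vp, w => ¬ Sat R V φ Vp w
  | .conj φ ψ, Vp, w => Sat R V φ Vp w ∧ Sat R V ψ Vp w
  | .dia φ, Vp, w => ∃ v, R w v ∧ Sat R V φ Vp v
  | .pdia φ, Vp, w => ∃ v, R w v ∧ Sat R V φ (insert v Vp) v

/-- A formula is PML-valid if it holds at every pointed model `(M,w)` with
`V(𝔭) = ∅`. -/
def PMLValid {A : Type} (φ : PForm A) : Prop :=
  ∀ (W : Type) (R : W → W → Prop) (V : A → Set W) (w : W), Sat R V φ ∅ w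

/-- The axiom holds at every pointed model, whatever the poison valuation. -/
theorem sat_general {A W : Type} (φ : PForm A) (R : W → W → Prop) (V : A → Set W)
    (Vp : Set W) (w : W) :
    Sat R V (PForm.impl (PForm.box PForm.poison)
      (PForm.iffF (PForm.pbox φ) (PForm.box φ))) Vp w := by
  simp only [PForm.impl, PForm.iffF, PForm.box, PForm.pbox, Sat]
  rintro ⟨h, hn⟩
  have key : ∀ v, R w v → insert v Vp = Vp := fun v hv =>
    Set.insert_eq_of_mem (by by_contra hc; exact h ⟨v, hv, hc⟩)
  apply hn
  constructor
  · rintro ⟨h1, h2⟩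
    apply h2
    rintro ⟨v, hv, hs⟩
    exact h1 ⟨v, hv, by rwa [key v hv]⟩
  · rintro ⟨h1, h2⟩
    apply h2
    rintro ⟨v, hv, hs⟩
    exact h1 ⟨v, hv, by rwa [key v hv] at hs⟩

/-- for every formula `φ`, `□𝔭 → (■φ ↔ □φ)` is PML-valid. -/
theorem stmt_4 {A : Type} (φ : PForm A) :
    PMLValid (PForm.impl (PForm.box PForm.poison)
      (PForm.iffF (PForm.pbox φ) (PForm.box φ))) := by
  intro W R V w
  exact sat_general φ R V ∅ w
end

section
/- PML is not invariant under standard modal bisimulation: there exist two pointed Kripke models (M,w) and (M',w') with V^M(𝔭) = V^{M'}(𝔭) = ∅ that are bisimilar in the standard modal sense, yet some formula φ of the poison modal language holds at (M,w) and fails at (M',w'). In particular, a single reflexive point and its unraveling into an infinite chain are standardly bisimilar but distinguished by a poison modal formula. -/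
/-- `Z` is a standard modal bisimulation between the models `(W₁,R₁,V₁,Vp₁)` and
`(W₂,R₂,V₂,Vp₂)` (atomic condition for all atoms in `P ∪ {𝔭}`, plus the usual
forth (zig) and back (zag) conditions for `R`). -/
def StdBisim {A W₁ W₂ : Type} (R₁ : W₁ → W₁ → Prop) (V₁ : A → Set W₁) (Vp₁ : Set W₁)
    (R₂ : W₂ → W₂ → Prop) (V₂ : A → Set W₂) (Vp₂ : Set W₂)
    (Z : W₁ → W₂ → Prop) : Prop :=
  ∀ w v, Z w v →
    ((∀ a, w ∈ V₁ a ↔ v ∈ V₂ a) ∧ (w ∈ Vp₁ ↔ v ∈ Vp₂)) ∧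
    (∀ w', R₁ w w' → ∃ v', R₂ v v' ∧ Z w' v') ∧
    (∀ v', R₂ v v' → ∃ w', R₁ w w' ∧ Z w' v')

/-- The single reflexive point. -/
def reflR : Unit → Unit → Prop := fun _ _ => True

/-- The infinite chain (the unraveling of the reflexive point). -/
def chainR : ℕ → ℕ → Prop := fun m n => n = m + 1

/-- PML is not invariant under standard modal bisimulation: there
are two pointed models with empty poison valuation that are standardly
bisimilar but are distinguished by a poison modal formula.  In particular, a
single reflexive point and its unraveling into an infinite chain (all ordinary
atoms false everywhere) are standardly bisimilar yet distinguished by some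
formula of `L^𝔭`. -/
theorem stmt_8 :
    (∃ (W₁ W₂ : Type) (R₁ : W₁ → W₁ → Prop) (V₁ : ℕ → Set W₁)
        (R₂ : W₂ → W₂ → Prop) (V₂ : ℕ → Set W₂) (Z : W₁ → W₂ → Prop)
        (w₁ : W₁) (w₂ : W₂),
        StdBisim R₁ V₁ ∅ R₂ V₂ ∅ Z ∧ Z w₁ w₂ ∧
        ∃ φ : PForm ℕ, Sat R₁ V₁ φ ∅ w₁ ∧ ¬ Sat R₂ V₂ φ ∅ w₂) ∧
    ((∃ Z : Unit → ℕ → Prop,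
        StdBisim reflR (fun _ : ℕ => (∅ : Set Unit)) ∅ chainR (fun _ : ℕ => (∅ : Set ℕ)) ∅ Z ∧
        Z () 0) ∧
      ∃ φ : PForm ℕ,
        Sat reflR (fun _ : ℕ => (∅ : Set Unit)) φ ∅ () ∧
        ¬ Sat chainR (fun _ : ℕ => (∅ : Set ℕ)) φ ∅ 0) := by
  have hZ : StdBisim reflR (fun _ : ℕ => (∅ : Set Unit)) ∅ chainR
      (fun _ : ℕ => (∅ : Set ℕ)) ∅ (fun _ _ => True) := by
    intro w v _
    refine ⟨⟨fun a => by simp, by simp⟩, fun w' _ => ⟨v + 1, rfl, trivial⟩,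
      fun v' _ => ⟨(), trivial, trivial⟩⟩
  have h1 : Sat reflR (fun _ : ℕ => (∅ : Set Unit))
      (PForm.pdia (PForm.dia PForm.poison)) ∅ () := by
    simp [Sat, reflR]
  have h2 : ¬ Sat chainR (fun _ : ℕ => (∅ : Set ℕ))
      (PForm.pdia (PForm.dia PForm.poison)) ∅ 0 := by
    simp [Sat, chainR]
  exact ⟨⟨Unit, ℕ, reflR, _, chainR, _, _, (), 0, hZ, trivial, _, h1, h2⟩,
    ⟨_, hZ, trivial⟩, _, h1, h2⟩
end

section
/- For every Kripke model M, every world w of M, every assignment g of first-order variables to worlds, every finite set of variables N, every variable x, and every poison modal formula φ: M•_w ⊨ ST^N_x(φ)[g] if and only if M ⊨ ST^{N∪{y}}_x(φ)[g_{y:=w}], where y is a fresh variable and g_{y:=w} is g updated to map y to w. -/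
/-- Formulas of the first-order correspondence language: a binary relation
symbol `R`, a unary predicate `pred a` for each atom `a ∈ P`, a unary predicate
`ppred` (written `𝔓`) for the poison atom, and equality.  Variables are coded
by natural numbers. -/
inductive FO (A : Type) : Type
  | pred : A → ℕ → FO A
  | ppred : ℕ → FO A
  | eq : ℕ → ℕ → FO A
  | rel : ℕ → ℕ → FO A
  | neg : FO A → FO A
  | conj : FO A → FO A → FO A
  | disj : FO A → FO A → FO A
  | ex : ℕ → FO A → FO A

/-- First-order satisfaction in the Kripke model `(W,R,V,Vp)` viewed as a
first-order structure, under the assignment `g`. -/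
def FOSat {A W : Type} (R : W → W → Prop) (V : A → Set W) (Vp : Set W) :
    FO A → (ℕ → W) → Prop
  | .pred a x, g => g x ∈ V a
  | .ppred x, g => g x ∈ Vp
  | .eq x y, g => g x = g y
  | .rel x y, g => R (g x) (g y)
  | .neg φ, g => ¬ FOSat R V Vp φ g
  | .conj φ ψ, g => FOSat R V Vp φ g ∧ FOSat R V Vp ψ g
  | .disj φ ψ, g => FOSat R V Vp φ g ∨ FOSat R V Vp ψ g
  | .ex x φ, g => ∃ w : W, FOSat R V Vp φ (Function.update g x w)

/-- Free variables of a first-order formula. -/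
def fv {A : Type} : FO A → Finset ℕ
  | .pred _ x => {x}
  | .ppred x => {x}
  | .eq x y => {x, y}
  | .rel x y => {x, y}
  | .neg φ => fv φ
  | .conj φ ψ => fv φ ∪ fv ψ
  | .disj φ ψ => fv φ ∪ fv ψ
  | .ex x φ => fv φ \ {x}

/-- The translation `ST^N_x` of poison modal formulas into first-order logic.
`N` is the (finite) set of book-keeping variables, here represented as a list;
`x` is the designated variable; `c` is a counter supplying fresh variables (all
variables occurring in `N ∪ {x}` are assumed to be `< c`, so that the
existential variable `c` used for `◇` and `◆` is fresh). -/
def STr {A : Type} : PForm A → List ℕ → ℕ → ℕ → FO A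
  | .atom a, _, x, _ => .pred a x
  | .poison, N, x, _ => N.foldr (fun y acc => .disj (.eq y x) acc) (.ppred x)
  | .neg φ, N, x, c => .neg (STr φ N x c)
  | .conj φ ψ, N, x, c => .conj (STr φ N x c) (STr ψ N x c)
  | .dia φ, N, x, c => .ex c (.conj (.rel x c) (STr φ N c (c + 1)))
  | .pdia φ, N, x, c => .ex c (.conj (.rel x c) (STr φ (c :: N) c (c + 1)))

theorem FOSat_foldr {A W : Type} (R : W → W → Prop) (V : A → Set W) (Vp : Set W)
    (N : List ℕ) (x : ℕ) (g : ℕ → W) :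
    FOSat R V Vp (N.foldr (fun y acc => FO.disj (.eq y x) acc) (.ppred x)) g ↔
      g x ∈ Vp ∪ {v | ∃ n ∈ N, g n = v} := by
  induction N with
  | nil => simp [FOSat]
  | cons a N ih =>
    simp only [List.foldr_cons, FOSat, ih]
    simp only [Set.mem_union, Set.mem_setOf_eq, List.mem_cons, exists_eq_or_imp]
    tauto

/-- Correctness of the translation. -/
theorem FOSat_STr {A W : Type} (R : W → W → Prop) (V : A → Set W) (Vp : Set W)
    (φ : PForm A) : ∀ (N : List ℕ) (x c : ℕ) (g : ℕ → W),
    x < c → (∀ n ∈ N, n < c) →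
    (FOSat R V Vp (STr φ N x c) g ↔
      Sat R V φ (Vp ∪ {v | ∃ n ∈ N, g n = v}) (g x)) := by
  have key : ∀ (N : List ℕ) (c : ℕ) (g : ℕ → W) (v : W), (∀ n ∈ N, n < c) →
      {u | ∃ n ∈ N, Function.update g c v n = u} = {u | ∃ n ∈ N, g n = u} := by
    intro N c g v hN
    ext u
    refine exists_congr fun n => and_congr_right fun hn => ?_
    rw [Function.update_of_ne (hN n hn).ne]
  induction φ with
  | atom a => intros; rfl
  | poison => intro N x c g _ _; exact FOSat_foldr R V Vp N x g
  | neg φ ih => intro N x c g hx hN; exact not_congr (ih N x c g hx hN)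
  | conj φ ψ ih1 ih2 =>
    intro N x c g hx hN
    exact and_congr (ih1 N x c g hx hN) (ih2 N x c g hx hN)
  | dia φ ih =>
    intro N x c g hx hN
    refine exists_congr fun v => ?_
    simp only [FOSat]
    rw [ih N c (c + 1) _ (by omega) (fun n hn => (hN n hn).trans (by omega)),
      key N c g v hN, Function.update_self, Function.update_of_ne hx.ne]
  | pdia φ ih =>
    intro N x c g hx hN
    refine exists_congr fun v => ?_
    simp only [FOSat]
    have hN' : ∀ n ∈ c :: N, n < c + 1 := by
      intro n hn
      rcases List.mem_cons.1 hn with h | h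
      · omega
      · have := hN n h
        omega
    have hs : Vp ∪ {u | ∃ n ∈ c :: N, Function.update g c v n = u} =
        insert v (Vp ∪ {u | ∃ n ∈ N, g n = u}) := by
      rw [← key N c g v hN]
      ext u
      simp only [Set.mem_union, Set.mem_setOf_eq, List.mem_cons, exists_eq_or_imp,
        Function.update_self, Set.mem_insert_iff, eq_comm (a := u)]
      tauto
    rw [ih (c :: N) c (c + 1) _ (by omega) hN', hs, Function.update_self,
      Function.update_of_ne hx.ne]

/-- Lemma 1: for every model `M`, world `w`, assignment `g`,
finite set of variables `N`, designated variable `x`, and poison modal formula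
`φ`:  `M•_w ⊨ ST^N_x(φ)[g]  iff  M ⊨ ST^{N∪{y}}_x(φ)[g_{y:=w}]`, where `y` is a
fresh variable (here `y = c`, the current fresh-variable counter, with the
freshness of `c` expressed by the hypotheses `x < c` and `n < c` for `n ∈ N`;
the translation on the right uses fresh variables starting from `c + 1`). -/
theorem stmt_9 {A W : Type} (R : W → W → Prop) (V : A → Set W) (Vp : Set W)
    (φ : PForm A) (N : List ℕ) (x c : ℕ) (g : ℕ → W) (w : W)
    (hx : x < c) (hN : ∀ n ∈ N, n < c) :
    FOSat R V (insert w Vp) (STr φ N x c) g ↔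
      FOSat R V Vp (STr φ (c :: N) x (c + 1)) (Function.update g c w) := by
  have hN' : ∀ n ∈ c :: N, n < c + 1 := by
    intro n hn
    rcases List.mem_cons.1 hn with h | h
    · omega
    · have := hN n h
      omega
  rw [FOSat_STr R V _ φ N x c g hx hN,
    FOSat_STr R V Vp φ (c :: N) x (c + 1) _ (by omega) hN', Function.update_of_ne hx.ne]
  have hs : insert w Vp ∪ {u | ∃ n ∈ N, g n = u} =
      Vp ∪ {u | ∃ n ∈ c :: N, Function.update g c w n = u} := by
    have key : ∀ u, (∃ n ∈ N, Function.update g c w n = u) ↔ ∃ n ∈ N, g n = u := by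
      intro u
      refine exists_congr fun n => and_congr_right fun hn => ?_
      rw [Function.update_of_ne (hN n hn).ne]
    ext u
    simp only [Set.mem_union, Set.mem_setOf_eq, List.mem_cons, exists_eq_or_imp,
      Function.update_self, Set.mem_insert_iff, key, eq_comm (a := u)]
    tauto
  rw [hs]
end

section
/- For every pointed Kripke model (M,w) and every poison modal formula φ: (M,w) ⊨ φ if and only if M ⊨ ST^∅_x(φ)[x:=w], i.e., the first-order translation with empty variable set and designated free variable x holds in M under the assignment sending x to w. -/
theorem foldr_sat_aux {A W : Type} (R : W → W → Prop) (V : A → Set W) (Vp : Set W)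
    (N : List ℕ) (x : ℕ) (g : ℕ → W) :
    FOSat R V Vp (N.foldr (fun y acc => FO.disj (.eq y x) acc) (.ppred x)) g ↔
      g x ∈ Vp ∨ ∃ y ∈ N, g y = g x := by
  induction N with
  | nil => simp [FOSat]
  | cons a N ih =>
    simp only [List.foldr_cons, FOSat, ih, List.mem_cons, exists_eq_or_imp]
    tauto

theorem STr_correct_aux {A W : Type} (R : W → W → Prop) (V : A → Set W) (Vp : Set W)
    (φ : PForm A) : ∀ (N : List ℕ) (x c : ℕ) (g : ℕ → W) (S : Set W), x < c →
      (∀ y ∈ N, y < c) → (∀ u, u ∈ S ↔ u ∈ Vp ∨ ∃ y ∈ N, g y = u) →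
      (Sat R V φ S (g x) ↔ FOSat R V Vp (STr φ N x c) g) := by
  induction φ with
  | atom a => intro N x c g S _ _ _; simp [Sat, STr, FOSat]
  | poison =>
    intro N x c g S _ _ hS
    simp only [Sat, STr]
    rw [foldr_sat_aux, hS]
  | neg φ ih =>
    intro N x c g S hx hN hS
    simp only [Sat, STr, FOSat, ih N x c g S hx hN hS]
  | conj φ ψ ih1 ih2 =>
    intro N x c g S hx hN hS
    simp only [Sat, STr, FOSat, ih1 N x c g S hx hN hS, ih2 N x c g S hx hN hS]
  | dia φ ih =>
    intro N x c g S hx hN hS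
    simp only [Sat, STr, FOSat]
    refine exists_congr fun v => ?_
    have hg : ∀ y, y < c → Function.update g c v y = g y := fun y hy =>
      Function.update_of_ne hy.ne _ _
    have h := ih N c (c + 1) (Function.update g c v) S (Nat.lt_succ_self c)
      (fun y hy => Nat.lt_succ_of_lt (hN y hy)) (fun u => by
        rw [hS u]
        refine or_congr Iff.rfl (exists_congr fun y => and_congr_right fun hy => ?_)
        rw [hg y (hN y hy)])
    rw [← h, hg x hx, Function.update_self]
  | pdia φ ih =>
    intro N x c g S hx hN hS
    simp only [Sat, STr, FOSat]
    refine exists_congr fun v => ?_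
    have hg : ∀ y, y < c → Function.update g c v y = g y := fun y hy =>
      Function.update_of_ne hy.ne _ _
    have h := ih (c :: N) c (c + 1) (Function.update g c v) (insert v S) (Nat.lt_succ_self c)
      (fun y hy => by
        rcases List.mem_cons.1 hy with rfl | hy
        · exact Nat.lt_succ_self _
        · exact Nat.lt_succ_of_lt (hN y hy)) (fun u => by
        have e : (∃ y ∈ N, Function.update g c v y = u) ↔ ∃ y ∈ N, g y = u :=
          exists_congr fun y => and_congr_right fun hy => by rw [hg y (hN y hy)]
        simp only [Set.mem_insert_iff, hS u, List.mem_cons, exists_eq_or_imp, e,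
          Function.update_self, eq_comm (a := u) (b := v)]
        tauto)
    rw [← h, hg x hx, Function.update_self]

/-- Theorem 4: for every pointed model `(M,w)` and poison modal
formula `φ`:  `(M,w) ⊨ φ  iff  M ⊨ ST^∅_x(φ)[x := w]` (for any designated
variable `x` and any background assignment `g`; fresh variables are supplied
starting from the counter `x + 1`). -/
theorem stmt_10 {A W : Type} (R : W → W → Prop) (V : A → Set W) (Vp : Set W)
    (φ : PForm A) (x : ℕ) (g : ℕ → W) (w : W) :
    Sat R V φ Vp w ↔
      FOSat R V Vp (STr φ [] x (x + 1)) (Function.update g x w) := by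
  have h := STr_correct_aux R V Vp φ [] x (x + 1) (Function.update g x w) Vp
    (Nat.lt_succ_self x) (by simp) (by simp)
  rwa [Function.update_self] at h
end

section
/- If two pointed Kripke models (M₁,w₁) and (M₂,w₂) are p-bisimilar, then they are poison modally equivalent, i.e., they satisfy exactly the same formulas of the poison modal language. -/
/-- `Z` is a p-bisimulation between the Kripke models `(W₁,R₁,V₁)` and
`(W₂,R₂,V₂)`.  Since the pointed models reachable by the poisoning relation
only differ from the original ones in the valuation of the poison atom `𝔭`,
`Z` relates pairs (poison valuation, world) of the two models.  The clauses
are: (Atom) for atoms in `P ∪ {𝔭}`; (Zig◇/Zag◇) for `R`-successors; and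
(Zig◆/Zag◆) for the poisoning relation `(M,w) →𝔭 (M•_{w'},w')` (matched
recursively, i.e. the resulting pointed models are again `Z`-related). -/
def IsPBisim {A W₁ W₂ : Type} (R₁ : W₁ → W₁ → Prop) (V₁ : A → Set W₁)
    (R₂ : W₂ → W₂ → Prop) (V₂ : A → Set W₂)
    (Z : Set W₁ → W₁ → Set W₂ → W₂ → Prop) : Prop :=
  ∀ P₁ w P₂ v, Z P₁ w P₂ v →
    ((∀ a, w ∈ V₁ a ↔ v ∈ V₂ a) ∧ (w ∈ P₁ ↔ v ∈ P₂)) ∧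
    (∀ w', R₁ w w' → ∃ v', R₂ v v' ∧ Z P₁ w' P₂ v') ∧
    (∀ v', R₂ v v' → ∃ w', R₁ w w' ∧ Z P₁ w' P₂ v') ∧
    (∀ w', R₁ w w' → ∃ v', R₂ v v' ∧ Z (insert w' P₁) w' (insert v' P₂) v') ∧
    (∀ v', R₂ v v' → ∃ w', R₁ w w' ∧ Z (insert w' P₁) w' (insert v' P₂) v')

/-- The pointed models `((W₁,R₁,V₁,P₁), w₁)` and `((W₂,R₂,V₂,P₂), w₂)` (where
`P₁`, `P₂` are the valuations of the poison atom) are p-bisimilar. -/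
def PBisimilar {A W₁ W₂ : Type} (R₁ : W₁ → W₁ → Prop) (V₁ : A → Set W₁)
    (R₂ : W₂ → W₂ → Prop) (V₂ : A → Set W₂)
    (P₁ : Set W₁) (w₁ : W₁) (P₂ : Set W₂) (w₂ : W₂) : Prop :=
  ∃ Z, IsPBisim R₁ V₁ R₂ V₂ Z ∧ Z P₁ w₁ P₂ w₂

/-- Theorem 3: p-bisimilar pointed models are poison modally
equivalent, i.e. they satisfy exactly the same formulas of `L^𝔭`. -/
theorem stmt_11 {A W₁ W₂ : Type} (R₁ : W₁ → W₁ → Prop) (V₁ : A → Set W₁)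
    (R₂ : W₂ → W₂ → Prop) (V₂ : A → Set W₂)
    (P₁ : Set W₁) (w₁ : W₁) (P₂ : Set W₂) (w₂ : W₂)
    (h : PBisimilar R₁ V₁ R₂ V₂ P₁ w₁ P₂ w₂) :
    ∀ φ : PForm A, Sat R₁ V₁ φ P₁ w₁ ↔ Sat R₂ V₂ φ P₂ w₂ := by
  obtain ⟨Z, hZ, h0⟩ := h
  intro φ
  induction φ generalizing P₁ w₁ P₂ w₂ with
  | atom a => exact (hZ _ _ _ _ h0).1.1 a
  | poison => exact (hZ _ _ _ _ h0).1.2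
  | neg φ ih => exact not_congr (ih _ _ _ _ h0)
  | conj φ ψ ih1 ih2 => exact and_congr (ih1 _ _ _ _ h0) (ih2 _ _ _ _ h0)
  | dia φ ih =>
    obtain ⟨-, zig, zag, -, -⟩ := hZ _ _ _ _ h0
    constructor
    · rintro ⟨w', hR, hs⟩
      obtain ⟨v', hR', hz⟩ := zig w' hR
      exact ⟨v', hR', (ih _ _ _ _ hz).1 hs⟩
    · rintro ⟨v', hR, hs⟩
      obtain ⟨w', hR', hz⟩ := zag v' hR
      exact ⟨w', hR', (ih _ _ _ _ hz).2 hs⟩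
  | pdia φ ih =>
    obtain ⟨-, -, -, zig, zag⟩ := hZ _ _ _ _ h0
    constructor
    · rintro ⟨w', hR, hs⟩
      obtain ⟨v', hR', hz⟩ := zig w' hR
      exact ⟨v', hR', (ih _ _ _ _ hz).1 hs⟩
    · rintro ⟨v', hR, hs⟩
      obtain ⟨w', hR', hz⟩ := zag v' hR
      exact ⟨w', hR', (ih _ _ _ _ hz).2 hs⟩
end

section
/- Let (M₁,w₁) and (M₂,w₂) be pointed Kripke models whose underlying first-order structures are ω-saturated. If (M₁,w₁) and (M₂,w₂) are poison modally equivalent, then they are p-bisimilar. -/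
/-- The Kripke model `(W,R,V,Vp)`, viewed as a structure for the first-order
language with `R`, unary predicates for the atoms in `P` and for `𝔭`, and
equality, is ω-saturated: for every assignment `g` of parameters, every
variable `x`, and every set `Γ` of formulas all of whose free variables lie in
`{x} ∪ S` for some finite set `S` of (parameter) variables, if every finite
subset of `Γ` is realized (with the parameters interpreted by `g`), then `Γ`
is realized. -/
def OmegaSaturated {A W : Type} (R : W → W → Prop) (V : A → Set W)
    (Vp : Set W) : Prop :=
  ∀ (g : ℕ → W) (x : ℕ) (S : Finset ℕ) (Γ : Set (FO A)),
    (∀ φ ∈ Γ, fv φ ⊆ insert x S) →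
    (∀ Γ₀ : Finset (FO A), ↑Γ₀ ⊆ Γ →
      ∃ w : W, ∀ φ ∈ Γ₀, FOSat R V Vp φ (Function.update g x w)) →
    ∃ w : W, ∀ φ ∈ Γ, FOSat R V Vp φ (Function.update g x w)

/-- The poison set `P` together with the values of the variables in `N`. -/
def pset {W : Type} (P : Set W) (N : List ℕ) (g : ℕ → W) : Set W :=
  {u | u ∈ P ∨ ∃ y ∈ N, g y = u}

theorem pset_update {W : Type} (P : Set W) (N : List ℕ) (g : ℕ → W) (c : ℕ) (v : W)
    (hN : ∀ y ∈ N, y < c) : pset P N (Function.update g c v) = pset P N g := by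
  ext u
  have : ∀ y ∈ N, Function.update g c v y = g y := fun y hy =>
    Function.update_of_ne (hN y hy).ne _ _
  simp only [pset, Set.mem_ofPred_eq]
  refine or_congr Iff.rfl ⟨?_, ?_⟩
  · rintro ⟨y, hy, h⟩
    exact ⟨y, hy, by rw [← h, this y hy]⟩
  · rintro ⟨y, hy, h⟩
    exact ⟨y, hy, by rw [← h, this y hy]⟩

theorem pset_cons {W : Type} (P : Set W) (N : List ℕ) (g : ℕ → W) (c : ℕ) :
    pset P (c :: N) g = insert (g c) (pset P N g) := by
  ext u
  simp only [pset, Set.mem_ofPred_eq, List.mem_cons, Set.mem_insert_iff, exists_eq_or_imp]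
  constructor
  · rintro (h | h | h)
    · exact Or.inr (Or.inl h)
    · exact Or.inl h.symm
    · exact Or.inr (Or.inr h)
  · rintro (h | h | h)
    · exact Or.inr (Or.inl h.symm)
    · exact Or.inl h
    · exact Or.inr (Or.inr h)

theorem pset_cons_update {W : Type} (P : Set W) (N : List ℕ) (g : ℕ → W) (c : ℕ) (v : W)
    (hN : ∀ y ∈ N, y < c) :
    pset P (c :: N) (Function.update g c v) = insert v (pset P N g) := by
  rw [pset_cons, pset_update _ _ _ _ _ hN, Function.update_self]

theorem fosat_STr {A W : Type} (R : W → W → Prop) (V : A → Set W) (P : Set W)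
    (φ : PForm A) : ∀ (N : List ℕ) (x c : ℕ) (g : ℕ → W), x < c → (∀ y ∈ N, y < c) →
    (FOSat R V P (STr φ N x c) g ↔ Sat R V φ (pset P N g) (g x)) := by
  induction φ with
  | atom a => intro N x c g _ _; rfl
  | poison =>
    intro N x c g _ _
    simp only [STr, Sat]
    clear * -
    induction N with
    | nil => simp [FOSat, pset]
    | cons y N ih =>
      rw [pset_cons, Set.mem_insert_iff, ← ih]
      simp only [List.foldr_cons, FOSat]
      exact or_congr eq_comm Iff.rfl
  | neg φ ih =>
    intro N x c g hx hN
    exact not_congr (ih N x c g hx hN)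
  | conj φ ψ ih1 ih2 =>
    intro N x c g hx hN
    exact and_congr (ih1 N x c g hx hN) (ih2 N x c g hx hN)
  | dia φ ih =>
    intro N x c g hx hN
    simp only [STr, Sat, FOSat]
    refine exists_congr fun v => ?_
    rw [ih N c (c+1) _ (by omega) (fun y hy => by have := hN y hy; omega),
      pset_update _ _ _ _ _ hN, Function.update_self, Function.update_of_ne hx.ne]
  | pdia φ ih =>
    intro N x c g hx hN
    simp only [STr, Sat, FOSat]
    refine exists_congr fun v => ?_
    rw [ih (c :: N) c (c+1) _ (by omega) (fun y hy => by
        rcases List.mem_cons.1 hy with h | h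
        · omega
        · have := hN y h; omega),
      pset_cons_update _ _ _ _ _ hN, Function.update_self, Function.update_of_ne hx.ne]

theorem fv_STr {A : Type} (φ : PForm A) : ∀ (N : List ℕ) (x c : ℕ),
    ∀ z ∈ fv (STr φ N x c), z = x ∨ z ∈ N := by
  induction φ with
  | atom a => intro N x c z hz; exact Or.inl (by simpa [STr, fv] using hz)
  | poison =>
    intro N x c z hz
    simp only [STr] at hz
    induction N with
    | nil => simpa [fv] using hz
    | cons y N ih =>
      simp only [List.foldr_cons, fv, Finset.mem_union, Finset.mem_insert,
        Finset.mem_singleton] at hz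
      rcases hz with (h | h) | h
      · exact Or.inr (by simp [h])
      · exact Or.inl h
      · rcases ih h with h | h
        · exact Or.inl h
        · exact Or.inr (List.mem_cons_of_mem _ h)
  | neg φ ih => intro N x c z hz; exact ih N x c z hz
  | conj φ ψ ih1 ih2 =>
    intro N x c z hz
    rcases Finset.mem_union.1 hz with h | h
    · exact ih1 N x c z h
    · exact ih2 N x c z h
  | dia φ ih =>
    intro N x c z hz
    simp only [STr, fv, Finset.mem_sdiff, Finset.mem_union, Finset.mem_insert,
      Finset.mem_singleton] at hz
    obtain ⟨(h | h) | h, hc⟩ := hz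
    · exact Or.inl h
    · exact absurd h hc
    · rcases ih _ _ _ z h with h | h
      · exact absurd h hc
      · exact Or.inr h
  | pdia φ ih =>
    intro N x c z hz
    simp only [STr, fv, Finset.mem_sdiff, Finset.mem_union, Finset.mem_insert,
      Finset.mem_singleton] at hz
    obtain ⟨(h | h) | h, hc⟩ := hz
    · exact Or.inl h
    · exact absurd h hc
    · rcases ih _ _ _ z h with h | h
      · exact absurd h hc
      · rcases List.mem_cons.1 h with h | h
        · exact absurd h hc
        · exact Or.inr h

/-- Saturation for successors, for a list `N'` of book-keeping variables. -/
theorem sat_succ {A W : Type} (R : W → W → Prop) (V : A → Set W) (P : Set W)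
    (hsat : OmegaSaturated R V P) (g : ℕ → W) (n : ℕ) (N : List ℕ)
    (hN : ∀ y ∈ N, y < n + 2) (Δ : Set (PForm A)) (hne : Δ.Nonempty)
    (hfin : ∀ s : Finset (PForm A), ↑s ⊆ Δ → ∃ v, R (g n) v ∧
      ∀ φ ∈ s, Sat R V φ (pset P N (Function.update g (n+1) v)) v) :
    ∃ v, R (g n) v ∧ ∀ φ ∈ Δ, Sat R V φ (pset P N (Function.update g (n+1) v)) v := by
  classical
  have key : ∀ (v : W) (φ : PForm A),
      FOSat R V P (.conj (.rel n (n+1)) (STr φ N (n+1) (n+2))) (Function.update g (n+1) v) ↔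
      R (g n) v ∧ Sat R V φ (pset P N (Function.update g (n+1) v)) v := by
    intro v φ
    simp only [FOSat]
    rw [fosat_STr R V P φ N (n+1) (n+2) _ (by omega) hN, Function.update_self,
      Function.update_of_ne (by omega)]
  obtain ⟨v, hv⟩ := hsat g (n+1) (Finset.range (n+2))
    ((fun φ => FO.conj (.rel n (n+1)) (STr φ N (n+1) (n+2))) '' Δ) (by
      rintro _ ⟨φ, _, rfl⟩ z hz
      simp only [fv, Finset.mem_union, Finset.mem_insert, Finset.mem_singleton] at hz
      rw [Finset.mem_insert, Finset.mem_range]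
      rcases hz with (h | h) | h
      · omega
      · omega
      · rcases fv_STr φ _ _ _ z h with h | h
        · omega
        · exact Or.inr (hN z h)) (by
      intro Γ₀ hΓ
      obtain ⟨s, hs, rfl⟩ := Finset.subset_set_image_iff.1 hΓ
      obtain ⟨v, hv, h⟩ := hfin s hs
      refine ⟨v, fun ψ hψ => ?_⟩
      obtain ⟨φ, hφ, rfl⟩ := Finset.mem_image.1 hψ
      exact (key v φ).2 ⟨hv, h φ hφ⟩)
  have h2 : ∀ φ ∈ Δ, R (g n) v ∧ Sat R V φ (pset P N (Function.update g (n+1) v)) v :=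
    fun φ hφ => (key v φ).1 (hv _ ⟨φ, hφ, rfl⟩)
  obtain ⟨φ, hφ⟩ := hne
  exact ⟨v, (h2 φ hφ).1, fun φ hφ => (h2 φ hφ).2⟩

/-- `Q` extends `P` by finitely many points. -/
def FinExt {W : Type} (P Q : Set W) : Prop :=
  ∃ (n : ℕ) (g : ℕ → W), Q = pset P (List.range n) g

theorem FinExt.insert {W : Type} {P Q : Set W} (h : FinExt P Q) (v : W) :
    FinExt P (insert v Q) := by
  obtain ⟨n, g, rfl⟩ := h
  refine ⟨n+1, Function.update g n v, ?_⟩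
  rw [← pset_cons_update _ _ _ _ _ (fun y hy => List.mem_range.1 hy)]
  ext u
  simp only [pset, Set.mem_ofPred_eq, List.mem_cons, List.mem_range, Order.lt_add_one_iff,
    le_iff_eq_or_lt]

def bigConj {A : Type} (l : List (PForm A)) : PForm A := l.foldr PForm.conj PForm.top

theorem sat_bigConj {A W : Type} (R : W → W → Prop) (V : A → Set W) (P : Set W) (w : W)
    (l : List (PForm A)) : Sat R V (bigConj l) P w ↔ ∀ φ ∈ l, Sat R V φ P w := by
  induction l with
  | nil => simp [bigConj, PForm.top, PForm.bot, Sat]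
  | cons φ l ih =>
    rw [List.forall_mem_cons, ← ih]
    rfl

theorem equiv_of_imp {A W₁ W₂ : Type}
    {R₁ : W₁ → W₁ → Prop} {V₁ : A → Set W₁} {Q₁ : Set W₁} {w : W₁}
    {R₂ : W₂ → W₂ → Prop} {V₂ : A → Set W₂} {Q₂ : Set W₂} {v : W₂}
    (h : ∀ φ : PForm A, Sat R₁ V₁ φ Q₁ w → Sat R₂ V₂ φ Q₂ v) (φ : PForm A) :
    Sat R₁ V₁ φ Q₁ w ↔ Sat R₂ V₂ φ Q₂ v := by
  refine ⟨h φ, fun h2 => ?_⟩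
  by_contra h3
  exact h (.neg φ) h3 h2

theorem zig {A W₁ W₂ : Type}
    (R₁ : W₁ → W₁ → Prop) (V₁ : A → Set W₁) (Q₁ : Set W₁) (w : W₁)
    (R₂ : W₂ → W₂ → Prop) (V₂ : A → Set W₂) (P₂ Q₂ : Set W₂) (v : W₂)
    (hsat : OmegaSaturated R₂ V₂ P₂) (hQ : FinExt P₂ Q₂)
    (he : ∀ φ : PForm A, Sat R₁ V₁ φ Q₁ w ↔ Sat R₂ V₂ φ Q₂ v) (w' : W₁) (hw : R₁ w w') :
    (∃ v', R₂ v v' ∧ ∀ φ : PForm A, Sat R₁ V₁ φ Q₁ w' ↔ Sat R₂ V₂ φ Q₂ v') ∧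
    (∃ v', R₂ v v' ∧ ∀ φ : PForm A,
      Sat R₁ V₁ φ (insert w' Q₁) w' ↔ Sat R₂ V₂ φ (insert v' Q₂) v') := by
  obtain ⟨n, g, rfl⟩ := hQ
  have hr : ∀ y ∈ List.range n, y < n := fun y hy => List.mem_range.1 hy
  have hr' : ∀ y ∈ List.range n, y < n + 1 := fun y hy => by have := hr y hy; omega
  have e1 : ∀ u, pset P₂ (List.range n)
      (Function.update (Function.update g n v) (n+1) u) = pset P₂ (List.range n) g := by
    intro u
    rw [pset_update _ _ _ _ _ hr', pset_update _ _ _ _ _ hr]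
  have e2 : ∀ u, pset P₂ ((n+1) :: List.range n)
      (Function.update (Function.update g n v) (n+1) u)
        = insert u (pset P₂ (List.range n) g) := by
    intro u
    rw [pset_cons_update _ _ _ _ _ hr', pset_update _ _ _ _ _ hr]
  have htop : ∀ Q : Set W₁, Sat R₁ V₁ PForm.top Q w' := fun Q =>
    (sat_bigConj R₁ V₁ Q w' []).2 (by simp)
  constructor
  · have := sat_succ R₂ V₂ P₂ hsat (Function.update g n v) n (List.range n)
      (fun y hy => by have := hr y hy; omega) {φ | Sat R₁ V₁ φ Q₁ w'} ⟨PForm.top, by rw [Set.mem_ofPred_eq]; exact htop _⟩ (by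
        intro s hs
        obtain ⟨u, hu, h⟩ := (he (.dia (bigConj s.toList))).1 ⟨w', hw,
          (sat_bigConj _ _ _ _ _).2 fun φ hφ => hs (Finset.mem_toList.1 hφ)⟩
        rw [Function.update_self]
        refine ⟨u, hu, fun φ hφ => ?_⟩
        rw [e1]
        exact (sat_bigConj _ _ _ _ _).1 h φ (Finset.mem_toList.2 hφ))
    obtain ⟨u, hu, h⟩ := this
    rw [Function.update_self] at hu
    rw [e1] at h
    exact ⟨u, hu, equiv_of_imp h⟩
  · have := sat_succ R₂ V₂ P₂ hsat (Function.update g n v) n ((n+1) :: List.range n)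
      (fun y hy => by
        rcases List.mem_cons.1 hy with h | h
        · omega
        · have := hr y h; omega) {φ | Sat R₁ V₁ φ (insert w' Q₁) w'} ⟨PForm.top, by rw [Set.mem_ofPred_eq]; exact htop _⟩ (by
        intro s hs
        obtain ⟨u, hu, h⟩ := (he (.pdia (bigConj s.toList))).1 ⟨w', hw,
          (sat_bigConj _ _ _ _ _).2 fun φ hφ => hs (Finset.mem_toList.1 hφ)⟩
        rw [Function.update_self]
        refine ⟨u, hu, fun φ hφ => ?_⟩
        rw [e2]
        exact (sat_bigConj _ _ _ _ _).1 h φ (Finset.mem_toList.2 hφ))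
    obtain ⟨u, hu, h⟩ := this
    rw [Function.update_self] at hu
    rw [e2] at h
    exact ⟨u, hu, equiv_of_imp h⟩

/-- Theorem 5: ω-saturated pointed models that are poison
modally equivalent are p-bisimilar. -/
theorem stmt_12 {A W₁ W₂ : Type}
    (R₁ : W₁ → W₁ → Prop) (V₁ : A → Set W₁) (P₁ : Set W₁) (w₁ : W₁)
    (R₂ : W₂ → W₂ → Prop) (V₂ : A → Set W₂) (P₂ : Set W₂) (w₂ : W₂)
    (hsat₁ : OmegaSaturated R₁ V₁ P₁) (hsat₂ : OmegaSaturated R₂ V₂ P₂)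
    (hequiv : ∀ φ : PForm A, Sat R₁ V₁ φ P₁ w₁ ↔ Sat R₂ V₂ φ P₂ w₂) :
    PBisimilar R₁ V₁ R₂ V₂ P₁ w₁ P₂ w₂ := by
  refine ⟨fun Q₁ w Q₂ v => FinExt P₁ Q₁ ∧ FinExt P₂ Q₂ ∧
    ∀ φ : PForm A, Sat R₁ V₁ φ Q₁ w ↔ Sat R₂ V₂ φ Q₂ v, ?_, ?_⟩
  · rintro Q₁ w Q₂ v ⟨h1, h2, he⟩
    have hz := zig R₁ V₁ Q₁ w R₂ V₂ P₂ Q₂ v hsat₂ h2 he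
    have hg := zig R₂ V₂ Q₂ v R₁ V₁ P₁ Q₁ w hsat₁ h1 (fun φ => (he φ).symm)
    refine ⟨⟨fun a => he (.atom a), he .poison⟩, ?_, ?_, ?_, ?_⟩
    · intro w' hw
      obtain ⟨v', hv, h⟩ := (hz w' hw).1
      exact ⟨v', hv, h1, h2, h⟩
    · intro v' hv
      obtain ⟨w', hw, h⟩ := (hg v' hv).1
      exact ⟨w', hw, h1, h2, fun φ => (h φ).symm⟩
    · intro w' hw
      obtain ⟨v', hv, h⟩ := (hz w' hw).2
      exact ⟨v', hv, h1.insert _, h2.insert _, h⟩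
    · intro v' hv
      obtain ⟨w', hw, h⟩ := (hg v' hv).2
      exact ⟨w', hw, h1.insert _, h2.insert _, fun φ => (h φ).symm⟩
  · exact ⟨⟨0, fun _ => w₁, by simp [pset]⟩, ⟨0, fun _ => w₂, by simp [pset]⟩, hequiv⟩
end

section
/- A first-order formula φ(x) with one free variable (in the first-order language with binary relation R, unary predicates for the atoms in P and for 𝔭, and equality) is logically equivalent to the translation ST^∅_x(ψ) of some poison modal formula ψ if and only if φ is invariant under p-bisimulation, i.e., for all p-bisimilar pointed models (M₁,w₁) and (M₂,w₂), M₁ ⊨ φ[x:=w₁] iff M₂ ⊨ φ[x:=w₂]. -/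
theorem foldr_sat {A W : Type} (R : W → W → Prop) (V : A → Set W) (Vp : Set W) (x : ℕ)
    (g : ℕ → W) (N : List ℕ) :
    FOSat R V Vp (N.foldr (fun y acc => FO.disj (.eq y x) acc) (.ppred x)) g ↔
      (g x ∈ Vp ∨ ∃ y ∈ N, g y = g x) := by
  induction N with
  | nil => simp [FOSat]
  | cons a N ih =>
    simp only [List.foldr_cons, FOSat, ih, List.mem_cons, exists_eq_or_imp]
    tauto

theorem STr_correct {A W : Type} (R : W → W → Prop) (V : A → Set W) (Vp : Set W)
    (ψ : PForm A) : ∀ (N : List ℕ) (x c : ℕ) (g : ℕ → W) (Q : Set W), x < c →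
      (∀ y ∈ N, y < c) → (∀ a, a ∈ Q ↔ (a ∈ Vp ∨ ∃ y ∈ N, g y = a)) →
      (FOSat R V Vp (STr ψ N x c) g ↔ Sat R V ψ Q (g x)) := by
  induction ψ with
  | atom a => intro N x c g Q _ _ _; simp [STr, FOSat, Sat]
  | poison =>
    intro N x c g Q _ _ hQ
    simp only [STr, Sat]
    rw [foldr_sat, hQ]
  | neg φ ih =>
    intro N x c g Q h1 h2 h3
    simp only [STr, Sat, FOSat]
    rw [ih N x c g Q h1 h2 h3]
  | conj φ χ ih1 ih2 =>
    intro N x c g Q h1 h2 h3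
    simp only [STr, Sat, FOSat]
    rw [ih1 N x c g Q h1 h2 h3, ih2 N x c g Q h1 h2 h3]
  | dia φ ih =>
    intro N x c g Q h1 h2 h3
    simp only [STr, Sat, FOSat]
    refine exists_congr fun v => ?_
    rw [ih N c (c+1) (Function.update g c v) Q (by omega)
      (fun y hy => by have := h2 y hy; omega)]
    · simp [Function.update_of_ne h1.ne]
    · intro a
      rw [h3]
      refine or_congr Iff.rfl (exists_congr fun y => and_congr_right fun hy => ?_)
      rw [Function.update_of_ne (h2 y hy).ne]
  | pdia φ ih =>
    intro N x c g Q h1 h2 h3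
    simp only [STr, Sat, FOSat]
    refine exists_congr fun v => ?_
    rw [ih (c :: N) c (c+1) (Function.update g c v) (insert v Q) (by omega)]
    · simp [Function.update_of_ne h1.ne]
    · intro y hy
      rcases List.mem_cons.1 hy with rfl | hy
      · omega
      · have := h2 y hy; omega
    · intro a
      have : (∃ y ∈ N, Function.update g c v y = a) ↔ ∃ y ∈ N, g y = a := by
        refine exists_congr fun y => and_congr_right fun hy => ?_
        rw [Function.update_of_ne (h2 y hy).ne]
      simp only [Set.mem_insert_iff, List.mem_cons, exists_eq_or_imp, h3, this,
        Function.update_self, eq_comm (a := a)]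
      tauto

theorem STr_correct0 {A W : Type} (R : W → W → Prop) (V : A → Set W) (Vp : Set W)
    (ψ : PForm A) (x : ℕ) (g : ℕ → W) :
    FOSat R V Vp (STr ψ [] x (x+1)) g ↔ Sat R V ψ Vp (g x) :=
  STr_correct R V Vp ψ [] x (x+1) g Vp (by omega) (by simp) (by simp)

theorem Sat_bisim {A W₁ W₂ : Type} {R₁ : W₁ → W₁ → Prop} {V₁ : A → Set W₁}
    {R₂ : W₂ → W₂ → Prop} {V₂ : A → Set W₂} {Z : Set W₁ → W₁ → Set W₂ → W₂ → Prop}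
    (hZ : IsPBisim R₁ V₁ R₂ V₂ Z) (ψ : PForm A) :
    ∀ P₁ w P₂ v, Z P₁ w P₂ v → (Sat R₁ V₁ ψ P₁ w ↔ Sat R₂ V₂ ψ P₂ v) := by
  induction ψ with
  | atom a => intro P₁ w P₂ v h; exact (hZ _ _ _ _ h).1.1 a
  | poison => intro P₁ w P₂ v h; exact (hZ _ _ _ _ h).1.2
  | neg φ ih => intro P₁ w P₂ v h; exact not_congr (ih _ _ _ _ h)
  | conj φ χ ih1 ih2 => intro P₁ w P₂ v h; exact and_congr (ih1 _ _ _ _ h) (ih2 _ _ _ _ h)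
  | dia φ ih =>
    intro P₁ w P₂ v h
    obtain ⟨_, zig, zag, _, _⟩ := hZ _ _ _ _ h
    constructor
    · rintro ⟨w', hr, hs⟩
      obtain ⟨v', hr', hz⟩ := zig w' hr
      exact ⟨v', hr', (ih _ _ _ _ hz).1 hs⟩
    · rintro ⟨v', hr, hs⟩
      obtain ⟨w', hr', hz⟩ := zag v' hr
      exact ⟨w', hr', (ih _ _ _ _ hz).2 hs⟩
  | pdia φ ih =>
    intro P₁ w P₂ v h
    obtain ⟨_, _, _, zig, zag⟩ := hZ _ _ _ _ h
    constructor
    · rintro ⟨w', hr, hs⟩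
      obtain ⟨v', hr', hz⟩ := zig w' hr
      exact ⟨v', hr', (ih _ _ _ _ hz).1 hs⟩
    · rintro ⟨v', hr, hs⟩
      obtain ⟨w', hr', hz⟩ := zag v' hr
      exact ⟨w', hr', (ih _ _ _ _ hz).2 hs⟩

theorem FOSat_congr {A W : Type} (R : W → W → Prop) (V : A → Set W) (Vp : Set W)
    (φ : FO A) : ∀ g h : ℕ → W, (∀ y ∈ fv φ, g y = h y) →
      (FOSat R V Vp φ g ↔ FOSat R V Vp φ h) := by
  induction φ with
  | pred a x => intro g h H; simp [FOSat, H x (by simp [fv])]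
  | ppred x => intro g h H; simp [FOSat, H x (by simp [fv])]
  | eq x y => intro g h H; simp [FOSat, H x (by simp [fv]), H y (by simp [fv])]
  | rel x y => intro g h H; simp [FOSat, H x (by simp [fv]), H y (by simp [fv])]
  | neg φ ih => intro g h H; exact not_congr (ih g h H)
  | conj φ χ ih1 ih2 =>
    intro g h H
    exact and_congr (ih1 g h fun y hy => H y (by simp [fv, hy]))
      (ih2 g h fun y hy => H y (by simp [fv, hy]))
  | disj φ χ ih1 ih2 =>
    intro g h H
    exact or_congr (ih1 g h fun y hy => H y (by simp [fv, hy]))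
      (ih2 g h fun y hy => H y (by simp [fv, hy]))
  | ex x φ ih =>
    intro g h H
    refine exists_congr fun w => ih _ _ fun y hy => ?_
    by_cases hyx : y = x
    · subst hyx; simp
    · simp [Function.update_of_ne hyx, H y (by simp [fv, hy, hyx])]

/-- Atoms of a first-order formula. -/
def foAtoms {A : Type} : FO A → List A
  | .pred a _ => [a]
  | .ppred _ => []
  | .eq _ _ => []
  | .rel _ _ => []
  | .neg φ => foAtoms φ
  | .conj φ ψ => foAtoms φ ++ foAtoms ψ
  | .disj φ ψ => foAtoms φ ++ foAtoms ψ
  | .ex _ φ => foAtoms φ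

/-- Complete conjunctions over a list of formulas. -/
def charForms {A : Type} : List (PForm A) → List (PForm A)
  | [] => [PForm.top]
  | t :: T => (charForms T).map (PForm.conj t) ++ (charForms T).map (PForm.conj (PForm.neg t))

/-- A hierarchy of finite lists of formulas over the atoms in `L`. -/
def levelForms {A : Type} (L : List A) : ℕ → List (PForm A)
  | 0 => PForm.poison :: L.map PForm.atom
  | k + 1 => levelForms L k ++ ((charForms (levelForms L k)).map PForm.dia ++
      (charForms (levelForms L k)).map PForm.pdia)

theorem charForms_exists {A W : Type} (R : W → W → Prop) (V : A → Set W) (Vp : Set W) (w : W)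
    (T : List (PForm A)) : ∃ c ∈ charForms T, Sat R V c Vp w := by
  induction T with
  | nil => exact ⟨PForm.top, by simp [charForms], by simp [PForm.top, PForm.bot, Sat]⟩
  | cons t T ih =>
    obtain ⟨c, hc, hs⟩ := ih
    by_cases h : Sat R V t Vp w
    · exact ⟨.conj t c, by simp [charForms, hc], h, hs⟩
    · exact ⟨.conj (.neg t) c, by simp [charForms, hc], h, hs⟩

theorem charForms_agree {A W₁ W₂ : Type} {R₁ : W₁ → W₁ → Prop} {V₁ : A → Set W₁}
    {R₂ : W₂ → W₂ → Prop} {V₂ : A → Set W₂} {P₁ : Set W₁} {w : W₁} {P₂ : Set W₂} {v : W₂}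
    (T : List (PForm A)) : ∀ c ∈ charForms T, Sat R₁ V₁ c P₁ w → Sat R₂ V₂ c P₂ v →
      ∀ t ∈ T, (Sat R₁ V₁ t P₁ w ↔ Sat R₂ V₂ t P₂ v) := by
  induction T with
  | nil => simp
  | cons t T ih =>
    intro c hc h1 h2 s hs
    simp only [charForms, List.mem_append, List.mem_map] at hc
    rcases hc with ⟨d, hd, rfl⟩ | ⟨d, hd, rfl⟩
    · rcases List.mem_cons.1 hs with rfl | hs
      · exact iff_of_true h1.1 h2.1
      · exact ih d hd h1.2 h2.2 s hs
    · rcases List.mem_cons.1 hs with rfl | hs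
      · exact iff_of_false h1.1 h2.1
      · exact ih d hd h1.2 h2.2 s hs

/-- Agreement of two pointed models on level `k`. -/
def Agree {A W₁ W₂ : Type} (L : List A) (k : ℕ) (R₁ : W₁ → W₁ → Prop) (V₁ : A → Set W₁)
    (R₂ : W₂ → W₂ → Prop) (V₂ : A → Set W₂) (P₁ : Set W₁) (w : W₁) (P₂ : Set W₂) (v : W₂) :
    Prop :=
  ∀ t ∈ levelForms L k, (Sat R₁ V₁ t P₁ w ↔ Sat R₂ V₂ t P₂ v)

section agree
variable {A W₁ W₂ : Type} {L : List A} {R₁ : W₁ → W₁ → Prop} {V₁ : A → Set W₁}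
    {R₂ : W₂ → W₂ → Prop} {V₂ : A → Set W₂} {P₁ : Set W₁} {w : W₁} {P₂ : Set W₂} {v : W₂}

theorem Agree.symm {k : ℕ} (h : Agree L k R₁ V₁ R₂ V₂ P₁ w P₂ v) :
    Agree L k R₂ V₂ R₁ V₁ P₂ v P₁ w := fun t ht => (h t ht).symm

theorem Agree.mono {k l : ℕ} (hkl : k ≤ l) (h : Agree L l R₁ V₁ R₂ V₂ P₁ w P₂ v) :
    Agree L k R₁ V₁ R₂ V₂ P₁ w P₂ v := by
  induction hkl with
  | refl => exact h
  | step _ ih => exact ih fun t ht => h t (by simp [levelForms, ht])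

theorem Agree.zig {k : ℕ} (h : Agree L (k+1) R₁ V₁ R₂ V₂ P₁ w P₂ v) (w' : W₁)
    (hr : R₁ w w') : ∃ v', R₂ v v' ∧ Agree L k R₁ V₁ R₂ V₂ P₁ w' P₂ v' := by
  obtain ⟨c, hc, hs⟩ := charForms_exists R₁ V₁ P₁ w' (levelForms L k)
  obtain ⟨v', hr', hs'⟩ := (h (.dia c) (by simp [levelForms, hc])).1 ⟨w', hr, hs⟩
  exact ⟨v', hr', charForms_agree _ c hc hs hs'⟩

theorem Agree.pzig {k : ℕ} (h : Agree L (k+1) R₁ V₁ R₂ V₂ P₁ w P₂ v) (w' : W₁)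
    (hr : R₁ w w') :
    ∃ v', R₂ v v' ∧ Agree L k R₁ V₁ R₂ V₂ (insert w' P₁) w' (insert v' P₂) v' := by
  obtain ⟨c, hc, hs⟩ := charForms_exists R₁ V₁ (insert w' P₁) w' (levelForms L k)
  obtain ⟨v', hr', hs'⟩ := (h (.pdia c) (by simp [levelForms, hc])).1 ⟨w', hr, hs⟩
  exact ⟨v', hr', charForms_agree _ c hc hs hs'⟩

end agree

theorem foldr_disj_sat {A W : Type} (R : W → W → Prop) (V : A → Set W) (Vp : Set W) (w : W)
    (T : List (PForm A)) :
    Sat R V (T.foldr PForm.disj PForm.bot) Vp w ↔ ∃ t ∈ T, Sat R V t Vp w := by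
  induction T with
  | nil => simp [PForm.bot, Sat]
  | cons t T ih =>
    simp only [List.foldr_cons, PForm.disj, Sat, ih, List.mem_cons, exists_eq_or_imp]
    exact or_iff_not_and_not.symm

/-- Bundled pointed models. -/
structure PMod (A : Type) where
  W : Type
  R : W → W → Prop
  V : A → Set W
  P : Set W
  w : W

def PMod.fo {A : Type} (M : PMod A) (φ : FO A) : Prop := FOSat M.R M.V M.P φ (fun _ => M.w)

def PMod.agree {A : Type} (L : List A) (k : ℕ) (M N : PMod A) : Prop :=
  Agree L k M.R M.V N.R N.V M.P M.w N.P N.w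

theorem definable_of_agree {A : Type} (L : List A) (k : ℕ) (φ : FO A)
    (H : ∀ M N : PMod A, M.agree L k N → M.fo φ → N.fo φ) :
    ∃ ψ : PForm A, ∀ M : PMod A, M.fo φ ↔ Sat M.R M.V ψ M.P M.w := by
  classical
  refine ⟨((charForms (levelForms L k)).filter
    (fun c => ∃ M : PMod A, M.fo φ ∧ Sat M.R M.V c M.P M.w)).foldr PForm.disj PForm.bot,
    fun M => ?_⟩
  rw [foldr_disj_sat]
  constructor
  · intro h
    obtain ⟨c, hc, hs⟩ := charForms_exists M.R M.V M.P M.w (levelForms L k)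
    exact ⟨c, by simpa [hc] using ⟨M, h, hs⟩, hs⟩
  · rintro ⟨c, hc, hs⟩
    simp only [List.mem_filter, decide_eq_true_eq] at hc
    obtain ⟨hc, N, hN, hNs⟩ := hc
    exact H N M (charForms_agree _ c hc hNs hs) hN

/-! Ultraproducts -/

section ultra
open Filter

variable (U : Ultrafilter ℕ)

/-- The ultraproduct domain. -/
abbrev UProd (W : ℕ → Type) : Type := Quotient ((U : Filter ℕ).productSetoid W)

variable {A : Type} {U} {W W₁ W₂ : ℕ → Type}

theorem UProd.out_ae (f : ∀ n, W n) :
    ∀ᶠ n in (U : Filter ℕ), (Quotient.mk ((U : Filter ℕ).productSetoid W) f).out n = f n :=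
  Quotient.mk_out (s := (U : Filter ℕ).productSetoid W) f

theorem UProd.eq_iff (a b : UProd U W) :
    a = b ↔ ∀ᶠ n in (U : Filter ℕ), a.out n = b.out n := by
  rw [← Quotient.out_equiv_out]
  rfl

def uR (R : ∀ n, W n → W n → Prop) (a b : UProd U W) : Prop :=
  ∀ᶠ n in (U : Filter ℕ), R n (a.out n) (b.out n)

def uS (P : ∀ n, Set (W n)) : Set (UProd U W) :=
  {a | ∀ᶠ n in (U : Filter ℕ), a.out n ∈ P n}

def uV (L : List A) (V : ∀ n, A → Set (W n)) (a : A) : Set (UProd U W) :=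
  {b | a ∈ L ∧ ∀ᶠ n in (U : Filter ℕ), b.out n ∈ V n a}

theorem uS_insert (P : ∀ n, Set (W n)) (a : UProd U W) :
    uS (fun n => insert (a.out n) (P n)) = insert a (uS P) := by
  ext b
  simp only [uS, Set.mem_setOf_eq, Set.mem_insert_iff, UProd.eq_iff]
  exact Ultrafilter.eventually_or

theorem los (L : List A) (R : ∀ n, W n → W n → Prop) (V : ∀ n, A → Set (W n))
    (P : ∀ n, Set (W n)) (φ : FO A) : (∀ a ∈ foAtoms φ, a ∈ L) → ∀ g : ℕ → UProd U W,
    (FOSat (uR R) (uV L V) (uS P) φ g ↔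
      ∀ᶠ n in (U : Filter ℕ), FOSat (R n) (V n) (P n) φ (fun i => (g i).out n)) := by
  induction φ with
  | pred a x =>
    intro h g
    simp [FOSat, uV, h a (by simp [foAtoms])]
  | ppred x => intro h g; rfl
  | eq x y => intro h g; exact UProd.eq_iff _ _
  | rel x y => intro h g; rfl
  | neg φ ih =>
    intro h g
    simp only [FOSat]
    rw [ih h g, Ultrafilter.eventually_not]
  | conj φ χ ih1 ih2 =>
    intro h g
    simp only [FOSat]
    rw [ih1 (fun a ha => h a (by simp [foAtoms, ha])), ih2 (fun a ha => h a (by simp [foAtoms, ha])),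
      eventually_and]
  | disj φ χ ih1 ih2 =>
    intro h g
    simp only [FOSat]
    rw [ih1 (fun a ha => h a (by simp [foAtoms, ha])), ih2 (fun a ha => h a (by simp [foAtoms, ha])),
      Ultrafilter.eventually_or]
  | ex x φ ih =>
    intro h g
    simp only [FOSat]
    have key : ∀ (w : UProd U W) n, (fun i => (Function.update g x w i).out n) =
        Function.update (fun i => (g i).out n) x (w.out n) := by
      intro w n
      ext i
      by_cases hi : i = x
      · subst hi; simp
      · simp [Function.update_of_ne hi]
    constructor
    · rintro ⟨w, hw⟩
      rw [ih h] at hw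
      filter_upwards [hw] with n hn
      rw [key] at hn
      exact ⟨_, hn⟩
    · intro H
      classical
      let f : ∀ n, W n := fun n =>
        if hn : ∃ w, FOSat (R n) (V n) (P n) φ (Function.update (fun i => (g i).out n) x w)
        then hn.choose else (g 0).out n
      refine ⟨Quotient.mk _ f, ?_⟩
      rw [ih h]
      filter_upwards [H, UProd.out_ae (U := U) f] with n hn hf
      rw [key, hf]
      simp only [f, dif_pos hn]
      exact hn.choose_spec

theorem diag (hU : (U : Filter ℕ) ≤ atTop) (W : ℕ → Type) [∀ n, Nonempty (W n)]
    (E : ℕ → ℕ → Prop) (S : ∀ n, ℕ → W n → Prop)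
    (hE : ∀ k, ∀ᶠ n in (U : Filter ℕ), E n k)
    (hES : ∀ n k, E n (k+1) → ∃ v, S n k v)
    (hS : ∀ n k l v, k ≤ l → S n l v → S n k v) :
    ∃ f : UProd U W, ∀ k, ∀ᶠ n in (U : Filter ℕ), S n k (f.out n) := by
  have h1 : ∀ n m, ∃ v : W n, ∀ k < m, E n (k+1) → S n k v := by
    intro n m
    induction m with
    | zero => exact ⟨Classical.arbitrary _, by simp⟩
    | succ m ih =>
      by_cases h : E n (m+1)
      · obtain ⟨v, hv⟩ := hES n m h
        exact ⟨v, fun k hk _ => hS n k m v (by omega) hv⟩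
      · obtain ⟨v, hv⟩ := ih
        refine ⟨v, fun k hk hk' => ?_⟩
        rcases Nat.lt_succ_iff_lt_or_eq.1 hk with h' | rfl
        · exact hv k h' hk'
        · exact absurd hk' h
  choose f hf using fun n => h1 n n
  refine ⟨Quotient.mk _ f, fun k => ?_⟩
  filter_upwards [hE (k+1), hU (eventually_gt_atTop k), UProd.out_ae (U := U) f] with n h1 h2 h3
  rw [h3]
  exact hf n k h2 h1

/-- The ultraproduct of agreement. -/
def uZ (U : Ultrafilter ℕ) (L : List A) (R₁ : ∀ n, W₁ n → W₁ n → Prop)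
    (V₁ : ∀ n, A → Set (W₁ n))
    (R₂ : ∀ n, W₂ n → W₂ n → Prop) (V₂ : ∀ n, A → Set (W₂ n))
    (Q₁ : Set (UProd U W₁)) (a : UProd U W₁) (Q₂ : Set (UProd U W₂)) (b : UProd U W₂) : Prop :=
  ∃ (P₁ : ∀ n, Set (W₁ n)) (P₂ : ∀ n, Set (W₂ n)), Q₁ = uS P₁ ∧ Q₂ = uS P₂ ∧
    ∀ k, ∀ᶠ n in (U : Filter ℕ),
      Agree L k (R₁ n) (V₁ n) (R₂ n) (V₂ n) (P₁ n) (a.out n) (P₂ n) (b.out n)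

variable {L : List A} {R₁ : ∀ n, W₁ n → W₁ n → Prop}
    {V₁ : ∀ n, A → Set (W₁ n)}
    {R₂ : ∀ n, W₂ n → W₂ n → Prop} {V₂ : ∀ n, A → Set (W₂ n)}
    {Q₁ : Set (UProd U W₁)} {a : UProd U W₁} {Q₂ : Set (UProd U W₂)} {b : UProd U W₂}

theorem uZ.symm (h : uZ U L R₁ V₁ R₂ V₂ Q₁ a Q₂ b) : uZ U L R₂ V₂ R₁ V₁ Q₂ b Q₁ a := by
  obtain ⟨P₁, P₂, h1, h2, h3⟩ := h
  exact ⟨P₂, P₁, h2, h1, fun k => (h3 k).mono fun n hn => hn.symm⟩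

theorem uZ.zig (hU : (U : Filter ℕ) ≤ atTop) (h : uZ U L R₁ V₁ R₂ V₂ Q₁ a Q₂ b)
    (a' : UProd U W₁) (hr : uR R₁ a a') :
    ∃ b', uR R₂ b b' ∧ uZ U L R₁ V₁ R₂ V₂ Q₁ a' Q₂ b' := by
  obtain ⟨P₁, P₂, h1, h2, h3⟩ := h
  haveI : ∀ n, Nonempty (W₂ n) := fun n => ⟨b.out n⟩
  obtain ⟨b', hb'⟩ := diag hU W₂
    (fun n k => R₁ n (a.out n) (a'.out n) ∧
      Agree L k (R₁ n) (V₁ n) (R₂ n) (V₂ n) (P₁ n) (a.out n) (P₂ n) (b.out n))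
    (fun n k v => R₂ n (b.out n) v ∧
      Agree L k (R₁ n) (V₁ n) (R₂ n) (V₂ n) (P₁ n) (a'.out n) (P₂ n) v)
    (fun k => hr.and (h3 k)) (fun n k h => h.2.zig _ h.1)
    (fun n k l v hkl h => ⟨h.1, h.2.mono hkl⟩)
  exact ⟨b', (hb' 0).mono fun n hn => hn.1, P₁, P₂, h1, h2,
    fun k => (hb' k).mono fun n hn => hn.2⟩

theorem uZ.pzig (hU : (U : Filter ℕ) ≤ atTop) (h : uZ U L R₁ V₁ R₂ V₂ Q₁ a Q₂ b)
    (a' : UProd U W₁) (hr : uR R₁ a a') :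
    ∃ b', uR R₂ b b' ∧ uZ U L R₁ V₁ R₂ V₂ (insert a' Q₁) a' (insert b' Q₂) b' := by
  obtain ⟨P₁, P₂, h1, h2, h3⟩ := h
  haveI : ∀ n, Nonempty (W₂ n) := fun n => ⟨b.out n⟩
  obtain ⟨b', hb'⟩ := diag hU W₂
    (fun n k => R₁ n (a.out n) (a'.out n) ∧
      Agree L k (R₁ n) (V₁ n) (R₂ n) (V₂ n) (P₁ n) (a.out n) (P₂ n) (b.out n))
    (fun n k v => R₂ n (b.out n) v ∧
      Agree L k (R₁ n) (V₁ n) (R₂ n) (V₂ n) (insert (a'.out n) (P₁ n)) (a'.out n)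
        (insert v (P₂ n)) v)
    (fun k => hr.and (h3 k)) (fun n k h => h.2.pzig _ h.1)
    (fun n k l v hkl h => ⟨h.1, h.2.mono hkl⟩)
  exact ⟨b', (hb' 0).mono fun n hn => hn.1, fun n => insert (a'.out n) (P₁ n),
    fun n => insert (b'.out n) (P₂ n), by rw [uS_insert, h1], by rw [uS_insert, h2],
    fun k => (hb' k).mono fun n hn => hn.2⟩

theorem uZ_bisim (hU : (U : Filter ℕ) ≤ atTop) :
    IsPBisim (uR R₁) (uV L V₁) (uR R₂) (uV L V₂) (uZ U L R₁ V₁ R₂ V₂) := by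
  intro Q₁ a Q₂ b h
  refine ⟨⟨?_, ?_⟩, h.zig hU, ?_, h.pzig hU, ?_⟩
  · obtain ⟨P₁, P₂, h1, h2, h3⟩ := h
    intro p
    refine and_congr_right fun hp => eventually_congr ?_
    filter_upwards [h3 0] with n hn
    exact hn (.atom p) (by simp [levelForms, hp])
  · obtain ⟨P₁, P₂, rfl, rfl, h3⟩ := h
    refine eventually_congr ?_
    filter_upwards [h3 0] with n hn
    exact hn .poison (by simp [levelForms])
  · intro b' hr
    obtain ⟨a', h1, h2⟩ := h.symm.zig hU b' hr
    exact ⟨a', h1, h2.symm⟩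
  · intro b' hr
    obtain ⟨a', h1, h2⟩ := h.symm.pzig hU b' hr
    exact ⟨a', h1, h2.symm⟩

end ultra

theorem exists_level {A : Type} (x : ℕ) (φ : FO A) (hfv : fv φ ⊆ {x})
    (H : ∀ (W₁ W₂ : Type) (R₁ : W₁ → W₁ → Prop) (V₁ : A → Set W₁) (P₁ : Set W₁) (w₁ : W₁)
        (R₂ : W₂ → W₂ → Prop) (V₂ : A → Set W₂) (P₂ : Set W₂) (w₂ : W₂),
        PBisimilar R₁ V₁ R₂ V₂ P₁ w₁ P₂ w₂ →
        (FOSat R₁ V₁ P₁ φ (fun _ => w₁) ↔ FOSat R₂ V₂ P₂ φ (fun _ => w₂))) :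
    ∃ k, ∀ M N : PMod A, M.agree (foAtoms φ) k N → M.fo φ → N.fo φ := by
  by_contra! hc
  choose M N hA hM hN using hc
  have hU : (Filter.hyperfilter ℕ : Filter ℕ) ≤ Filter.atTop := by
    rw [← Nat.cofinite_eq_atTop]
    exact Filter.hyperfilter_le_cofinite
  generalize Filter.hyperfilter ℕ = U at hU
  let a : UProd U (fun n => (M n).W) := Quotient.mk _ (fun n => (M n).w)
  let b : UProd U (fun n => (N n).W) := Quotient.mk _ (fun n => (N n).w)
  have ha : ∀ᶠ n in (U : Filter ℕ), a.out n = (M n).w := UProd.out_ae _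
  have hb : ∀ᶠ n in (U : Filter ℕ), b.out n = (N n).w := UProd.out_ae _
  have key := H _ _ (uR fun n => (M n).R) (uV (foAtoms φ) fun n => (M n).V) (uS fun n => (M n).P) a
    (uR fun n => (N n).R) (uV (foAtoms φ) fun n => (N n).V) (uS fun n => (N n).P) b
    ⟨uZ U (foAtoms φ) _ _ _ _, uZ_bisim hU, _, _, rfl, rfl, fun k => by
      filter_upwards [ha, hb, hU (Filter.eventually_ge_atTop k)] with n h1 h2 h3
      rw [h1, h2]
      exact Agree.mono h3 (hA n)⟩
  rw [los _ _ _ _ _ (fun _ h => h), los _ _ _ _ _ (fun _ h => h)] at key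
  have h1 := key.1 (by
    filter_upwards [ha] with n hn
    simp only [hn]
    exact hM n)
  obtain ⟨n, h2, h3⟩ := (h1.and hb).exists
  simp only [h3] at h2
  exact hN n h2

/-- Theorem 6, characterization: a first-order formula `φ` with
one free variable `x` (in the correspondence language) is logically equivalent
(over all Kripke models, viewed as first-order structures) to the translation
`ST^∅_x(ψ)` of some poison modal formula `ψ` if and only if `φ` is invariant
under p-bisimulation: for all p-bisimilar pointed models `(M₁,w₁)` and
`(M₂,w₂)`, `M₁ ⊨ φ[x := w₁]` iff `M₂ ⊨ φ[x := w₂]`.  (Since `fv φ ⊆ {x}`,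
satisfaction of `φ` under the constant assignment `fun _ => w` is satisfaction
under `[x := w]`.) -/
theorem stmt_13 {A : Type} (x : ℕ) (φ : FO A) (hfv : fv φ ⊆ {x}) :
    (∃ ψ : PForm A,
      ∀ (W : Type) (R : W → W → Prop) (V : A → Set W) (Vp : Set W) (g : ℕ → W),
        FOSat R V Vp φ g ↔ FOSat R V Vp (STr ψ [] x (x + 1)) g) ↔
    (∀ (W₁ W₂ : Type) (R₁ : W₁ → W₁ → Prop) (V₁ : A → Set W₁) (P₁ : Set W₁) (w₁ : W₁)
        (R₂ : W₂ → W₂ → Prop) (V₂ : A → Set W₂) (P₂ : Set W₂) (w₂ : W₂),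
        PBisimilar R₁ V₁ R₂ V₂ P₁ w₁ P₂ w₂ →
        (FOSat R₁ V₁ P₁ φ (fun _ => w₁) ↔ FOSat R₂ V₂ P₂ φ (fun _ => w₂))) := by
  have hx : ∀ (W : Type) (R : W → W → Prop) (V : A → Set W) (Vp : Set W) (g : ℕ → W),
      FOSat R V Vp φ g ↔ FOSat R V Vp φ (fun _ => g x) := by
    intro W R V Vp g
    refine FOSat_congr R V Vp φ _ _ fun y hy => ?_
    rw [Finset.mem_singleton.1 (hfv hy)]
  constructor
  · rintro ⟨ψ, hψ⟩ W₁ W₂ R₁ V₁ P₁ w₁ R₂ V₂ P₂ w₂ ⟨Z, hZ, hz⟩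
    rw [hψ, hψ, STr_correct0, STr_correct0]
    exact Sat_bisim hZ ψ _ _ _ _ hz
  · intro H
    obtain ⟨k, hk⟩ := exists_level x φ hfv H
    obtain ⟨ψ, hψ⟩ := definable_of_agree _ k φ hk
    refine ⟨ψ, fun W R V Vp g => ?_⟩
    rw [STr_correct0, hx]
    exact hψ ⟨W, R, V, Vp, g x⟩
end

section
/- The translation MT from the poison modal language into the memory logic M(ⓡ,ⓚ), defined by MT(p) = p for p ∈ P, MT(𝔭) = ⓚ, MT commuting with ¬, ∧, and ◇, and MT(◆φ) = ◇ⓡMT(φ), is truth-preserving: for every Kripke model M = (W,R,V), every world w, and every poison modal formula φ, (M,w) ⊨ φ in poison semantics (with memory set M identified with V(𝔭)) if and only if (W,R,V(𝔭),V,w) ⊨ MT(φ) in memory-logic semantics. -/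
/-- Formulas of the memory logic `M(ⓡ,ⓚ)`: the standard modal language plus
the unary `remember` operator `ⓡ` and the nullary `known` operator `ⓚ`. -/
inductive MForm (A : Type) : Type
  | atom : A → MForm A
  | known : MForm A
  | neg : MForm A → MForm A
  | conj : MForm A → MForm A → MForm A
  | dia : MForm A → MForm A
  | remember : MForm A → MForm A

/-- Memory-logic satisfaction on structures `(W, R, Mem, V)`, where
`Mem ⊆ W` is the memory set: `ⓡφ` stores the current world in the memory,
and `ⓚ` holds iff the current world is in the memory. -/
def MSat {A W : Type} (R : W → W → Prop) (V : A → Set W) :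
    MForm A → Set W → W → Prop
  | .atom a, _, w => w ∈ V a
  | .known, Mem, w => w ∈ Mem
  | .neg φ, Mem, w => ¬ MSat R V φ Mem w
  | .conj φ ψ, Mem, w => MSat R V φ Mem w ∧ MSat R V ψ Mem w
  | .dia φ, Mem, w => ∃ v, R w v ∧ MSat R V φ Mem v
  | .remember φ, Mem, w => MSat R V φ (insert w Mem) w

/-- The translation `MT` of the poison modal language into `M(ⓡ,ⓚ)`:
`MT(𝔭) = ⓚ`, `MT(◆φ) = ◇ⓡMT(φ)`, and `MT` commutes with everything else. -/
def MT {A : Type} : PForm A → MForm A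
  | .atom a => .atom a
  | .poison => .known
  | .neg φ => .neg (MT φ)
  | .conj φ ψ => .conj (MT φ) (MT ψ)
  | .dia φ => .dia (MT φ)
  | .pdia φ => .dia (.remember (MT φ))

/-- the translation `MT` is truth-preserving: for every Kripke
model `M = (W,R,V)` (with poison valuation `Vp = V(𝔭)`), every world `w`, and
every poison modal formula `φ`, `(M,w) ⊨ φ` in poison semantics iff
`((W,R,Vp,V),w) ⊨ MT(φ)` in memory-logic semantics (the memory set being
identified with `V(𝔭)`). -/
theorem stmt_16 {A W : Type} (R : W → W → Prop) (V : A → Set W) (Vp : Set W)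
    (w : W) (φ : PForm A) :
    Sat R V φ Vp w ↔ MSat R V (MT φ) Vp w := by
  induction φ generalizing Vp w with
  | atom a => simp only [Sat, MT, MSat]
  | poison => simp only [Sat, MT, MSat]
  | neg φ ih => simp only [Sat, MT, MSat, ih]
  | conj φ ψ ih1 ih2 => simp only [Sat, MT, MSat, ih1, ih2]
  | dia φ ih => simp only [Sat, MT, MSat, ih]
  | pdia φ ih => simp only [Sat, MT, MSat, ih]
end

section
/- The memory logic M(ⓡ,ⓚ) is strictly more expressive than PML: there exist two pointed models (M,w₁) and (M',w₁') (on structures where the memory set is identified with V(𝔭) and is empty) that are p-bisimilar—hence satisfy the same poison modal formulas—but such that the memory logic formula ⓡ◇◇ⓚ holds at (M',w₁') and fails at (M,w₁). Concretely, M has domain {w₁,w₂,w₃} with edges w₁→w₂, w₂→w₃, w₃→w₂ and M' has domain {w₁',w₂'} with edges w₁'→w₂' and w₂'→w₁', all atoms in P false everywhere and V(𝔭) = ∅. -/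
/-- The model `M`: worlds `w₁ = 0, w₂ = 1, w₃ = 2` with edges
`w₁ → w₂`, `w₂ → w₃`, `w₃ → w₂`. -/
def RM : Fin 3 → Fin 3 → Prop := fun a b =>
  (a = 0 ∧ b = 1) ∨ (a = 1 ∧ b = 2) ∨ (a = 2 ∧ b = 1)

/-- The model `M'`: worlds `w₁' = 0, w₂' = 1` with edges `w₁' → w₂'` and
`w₂' → w₁'`. -/
def RM' : Fin 2 → Fin 2 → Prop := fun a b =>
  (a = 0 ∧ b = 1) ∨ (a = 1 ∧ b = 0)

/-- Poison modal formulas are invariant under p-bisimulations. -/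
theorem sat_iff_of_isPBisim {A W₁ W₂ : Type} {R₁ : W₁ → W₁ → Prop} {V₁ : A → Set W₁}
    {R₂ : W₂ → W₂ → Prop} {V₂ : A → Set W₂}
    {Z : Set W₁ → W₁ → Set W₂ → W₂ → Prop} (hZ : IsPBisim R₁ V₁ R₂ V₂ Z) (φ : PForm A) :
    ∀ P₁ w P₂ v, Z P₁ w P₂ v → (Sat R₁ V₁ φ P₁ w ↔ Sat R₂ V₂ φ P₂ v) := by
  induction φ with
  | atom a => intro P₁ w P₂ v h; exact (hZ _ _ _ _ h).1.1 a
  | poison => intro P₁ w P₂ v h; exact (hZ _ _ _ _ h).1.2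
  | neg φ ih => intro P₁ w P₂ v h; exact not_congr (ih _ _ _ _ h)
  | conj φ ψ ih₁ ih₂ =>
    intro P₁ w P₂ v h; exact and_congr (ih₁ _ _ _ _ h) (ih₂ _ _ _ _ h)
  | dia φ ih =>
    intro P₁ w P₂ v h
    obtain ⟨-, h1, h2, -, -⟩ := hZ _ _ _ _ h
    constructor
    · rintro ⟨w', hw, hs⟩
      obtain ⟨v', hv, hz⟩ := h1 w' hw
      exact ⟨v', hv, (ih _ _ _ _ hz).1 hs⟩
    · rintro ⟨v', hv, hs⟩
      obtain ⟨w', hw, hz⟩ := h2 v' hv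
      exact ⟨w', hw, (ih _ _ _ _ hz).2 hs⟩
  | pdia φ ih =>
    intro P₁ w P₂ v h
    obtain ⟨-, -, -, h1, h2⟩ := hZ _ _ _ _ h
    constructor
    · rintro ⟨w', hw, hs⟩
      obtain ⟨v', hv, hz⟩ := h1 w' hw
      exact ⟨v', hv, (ih _ _ _ _ hz).1 hs⟩
    · rintro ⟨v', hv, hs⟩
      obtain ⟨w', hw, hz⟩ := h2 v' hv
      exact ⟨w', hw, (ih _ _ _ _ hz).2 hs⟩

/-- The p-bisimulation between the two concrete models. -/
def ZM (P₁ : Set (Fin 3)) (w : Fin 3) (P₂ : Set (Fin 2)) (v : Fin 2) : Prop :=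
  ((1 ∈ P₁ ↔ 1 ∈ P₂) ∧ (2 ∈ P₁ ↔ 0 ∈ P₂)) ∧
    ((w = 1 ∧ v = 1) ∨ (w = 2 ∧ v = 0) ∨ (w = 0 ∧ v = 0 ∧ (0 ∈ P₁ ↔ 0 ∈ P₂)))

theorem isPBisim_ZM : IsPBisim RM (fun _ : ℕ => (∅ : Set (Fin 3)))
    RM' (fun _ : ℕ => (∅ : Set (Fin 2))) ZM := by
  rintro P₁ w P₂ v ⟨⟨h1, h2⟩, (⟨rfl, rfl⟩ | ⟨rfl, rfl⟩ | ⟨rfl, rfl, h3⟩)⟩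
  · simp [RM, RM', ZM, h1, h2]
  · simp [RM, RM', ZM, h1, h2]
  · simp [RM, RM', ZM, h1, h2, h3]

theorem ZM_start : ZM ∅ 0 ∅ 0 := by simp [ZM]

/-- Proposition 3: the memory logic `M(ⓡ,ⓚ)` is strictly more
expressive than PML.  The two concrete pointed models `(M,w₁)` and `(M',w₁')`
above (all ordinary atoms false everywhere, memory set = `V(𝔭) = ∅`) are
p-bisimilar — hence satisfy the same poison modal formulas — yet the
memory-logic formula `ⓡ◇◇ⓚ` holds at `(M',w₁')` and fails at `(M,w₁)`. -/
theorem stmt_17 :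
    PBisimilar RM (fun _ : ℕ => (∅ : Set (Fin 3))) RM' (fun _ : ℕ => (∅ : Set (Fin 2)))
      ∅ 0 ∅ 0 ∧
    (∀ φ : PForm ℕ,
      Sat RM (fun _ : ℕ => (∅ : Set (Fin 3))) φ ∅ 0 ↔
      Sat RM' (fun _ : ℕ => (∅ : Set (Fin 2))) φ ∅ 0) ∧
    MSat RM' (fun _ : ℕ => (∅ : Set (Fin 2)))
      (MForm.remember (MForm.dia (MForm.dia MForm.known))) ∅ 0 ∧
    ¬ MSat RM (fun _ : ℕ => (∅ : Set (Fin 3)))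
      (MForm.remember (MForm.dia (MForm.dia MForm.known))) ∅ 0 := by
  refine ⟨⟨ZM, isPBisim_ZM, ZM_start⟩,
    fun φ => sat_iff_of_isPBisim isPBisim_ZM φ _ _ _ _ ZM_start, ?_, ?_⟩
  · simp [MSat, RM']
  · simp [MSat, RM]
end

section
/- Let M = (W,R,V) be a Kripke model and M_H = (W,R,V') its hybrid extension. For all worlds v, w ∈ W, every assignment g of state variables to worlds, every finite set S of state variables, every fresh variable x, and every poison modal formula φ: (M_H•_v, g, w) ⊨_H HT^S(φ) if and only if (M_H, g^x_v, w) ⊨_H HT^{S∪{x}}(φ), where g^x_v is the x-variant of g mapping x to v. -/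
/-- Formulas of the hybrid logic `H(↓)`: atoms in `P ∪ {𝔭}`, nominals/state
variables (coded by natural numbers), Booleans, `◇`, and the binder `↓x.φ`. -/
inductive HForm (A : Type) : Type
  | atom : A → HForm A
  | poison : HForm A
  | nom : ℕ → HForm A
  | neg : HForm A → HForm A
  | conj : HForm A → HForm A → HForm A
  | dia : HForm A → HForm A
  | bind : ℕ → HForm A → HForm A

/-- Hybrid satisfaction `(M, g, w) ⊨_H φ` on the hybrid extension of the Kripke
model `(W,R,V,Vp)` (`Vp` is the valuation of `𝔭`): nominals are interpreted by
the assignment `g` (so each nominal names exactly one world), `(M,g,w) ⊨_H i`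
iff `w = g(i)`, and `↓x.φ` rebinds `x` to the current world. -/
def HSat {A W : Type} (R : W → W → Prop) (V : A → Set W) (Vp : Set W) :
    HForm A → (ℕ → W) → W → Prop
  | .atom a, _, w => w ∈ V a
  | .poison, _, w => w ∈ Vp
  | .nom i, g, w => w = g i
  | .neg φ, g, w => ¬ HSat R V Vp φ g w
  | .conj φ ψ, g, w => HSat R V Vp φ g w ∧ HSat R V Vp ψ g w
  | .dia φ, g, w => ∃ v, R w v ∧ HSat R V Vp φ g v
  | .bind x φ, g, w => HSat R V Vp φ (Function.update g x w) w

/-- Hybrid disjunction. -/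
def hdisj {A : Type} (φ ψ : HForm A) : HForm A :=
  HForm.neg (HForm.conj (HForm.neg φ) (HForm.neg ψ))

/-- The translation `HT^S` of the poison modal language into `H(↓)`.  `S` is
the (finite) set of book-keeping state variables, represented as a list; `c`
is a counter supplying fresh variables (all variables in `S` are assumed to be
`< c`, so the variable `c` bound for `◆` is fresh, never used before):
`HT^S(𝔭) = 𝔭 ∨ ⋁_{i∈S} i` and `HT^S(◆φ) = ◇(↓x.HT^{S∪{x}}(φ))`. -/
def HT {A : Type} : PForm A → List ℕ → ℕ → HForm A
  | .atom a, _, _ => .atom a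
  | .poison, S, _ => S.foldr (fun i acc => hdisj (.nom i) acc) .poison
  | .neg φ, S, c => .neg (HT φ S c)
  | .conj φ ψ, S, c => .conj (HT φ S c) (HT ψ S c)
  | .dia φ, S, c => .dia (HT φ S c)
  | .pdia φ, S, c => .dia (.bind c (HT φ (c :: S) (c + 1)))

theorem update_set_eq {W : Type} (Vp : Set W) (g : ℕ → W) (S : List ℕ) (c : ℕ) (v : W)
    (h : ∀ n ∈ S, n < c) :
    Vp ∪ {u | ∃ i ∈ c :: S, u = Function.update g c v i} =
      insert v (Vp ∪ {u | ∃ i ∈ S, u = g i}) := by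
  ext x
  have e : (∃ i ∈ S, x = Function.update g c v i) ↔ ∃ i ∈ S, x = g i := by
    refine exists_congr fun i => and_congr_right fun hi => ?_
    rw [Function.update_of_ne (h i hi).ne]
  simp only [Set.mem_union, Set.mem_ofPred_eq, List.mem_cons, exists_eq_or_imp,
    Function.update_self, Set.mem_insert_iff, e]
  tauto

theorem HSat_foldr_iff {A W : Type} (R : W → W → Prop) (V : A → Set W) (Vp : Set W)
    (g : ℕ → W) (w : W) (S : List ℕ) :
    HSat R V Vp (S.foldr (fun i acc => hdisj (.nom i) acc) (HForm.poison : HForm A)) g w ↔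
      w ∈ Vp ∪ {u | ∃ i ∈ S, u = g i} := by
  induction S with
  | nil => simp [HSat]
  | cons a S ih =>
    change ¬ (¬ w = g a ∧ ¬ HSat R V Vp _ g w) ↔ _
    rw [ih]
    simp only [Set.mem_union, Set.mem_ofPred_eq, List.mem_cons, exists_eq_or_imp]
    clear ih
    generalize (∃ i ∈ S, w = g i) = q
    tauto

theorem HT_correct {A W : Type} (R : W → W → Prop) (V : A → Set W) (Vp : Set W)
    (φ : PForm A) : ∀ (S : List ℕ) (c : ℕ) (g : ℕ → W) (w : W), (∀ n ∈ S, n < c) →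
    (HSat R V Vp (HT φ S c) g w ↔ Sat R V φ (Vp ∪ {u | ∃ i ∈ S, u = g i}) w) := by
  induction φ with
  | atom a => intros; rfl
  | poison => intro S c g w _; exact HSat_foldr_iff R V Vp g w S
  | neg φ ih => intro S c g w h; exact not_congr (ih S c g w h)
  | conj φ ψ ih1 ih2 =>
    intro S c g w h; exact and_congr (ih1 S c g w h) (ih2 S c g w h)
  | dia φ ih =>
    intro S c g w h; exact exists_congr fun u => and_congr Iff.rfl (ih S c g u h)
  | pdia φ ih =>
    intro S c g w h
    refine exists_congr fun u => and_congr Iff.rfl ?_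
    have h' : ∀ n ∈ c :: S, n < c + 1 := by
      intro n hn
      rcases List.mem_cons.1 hn with rfl | hn
      · omega
      · have := h n hn; omega
    refine (ih (c :: S) (c + 1) (Function.update g c u) u h').trans ?_
    rw [update_set_eq Vp g S c u h]

/-- Lemma 2: for the hybrid extension `M_H` of a Kripke model
`M = (W,R,V)` (poison valuation `Vp`), all `v, w ∈ W`, every assignment `g`,
every finite set `S` of state variables and fresh variable `x`, and every
poison modal formula `φ`:
`(M_H•_v, g, w) ⊨_H HT^S(φ)  iff  (M_H, g^x_v, w) ⊨_H HT^{S∪{x}}(φ)`.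
Here the fresh variable `x` is the counter `c` (freshness is expressed by the
hypothesis that all variables in `S` are `< c`; on the right the translation
uses fresh variables starting from `c + 1`). -/
theorem stmt_18 {A W : Type} (R : W → W → Prop) (V : A → Set W) (Vp : Set W)
    (v w : W) (g : ℕ → W) (S : List ℕ) (c : ℕ) (φ : PForm A)
    (hS : ∀ n ∈ S, n < c) :
    HSat R V (insert v Vp) (HT φ S c) g w ↔
      HSat R V Vp (HT φ (c :: S) (c + 1)) (Function.update g c v) w := by
  have h' : ∀ n ∈ c :: S, n < c + 1 := by
    intro n hn
    rcases List.mem_cons.1 hn with rfl | hn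
    · omega
    · have := hS n hn; omega
  rw [HT_correct R V _ φ S c g w hS, HT_correct R V _ φ (c :: S) (c + 1) _ w h',
    update_set_eq Vp g S c v hS, Set.insert_union]
end

section
/- Let M = (W,R,V) be a Kripke model, M_H = (W,R,V') its hybrid extension, and g any assignment. For every world w ∈ W and every poison modal formula φ: (M,w) ⊨ φ in poison semantics if and only if (M_H, g, w) ⊨_H HT^∅(φ) in the hybrid logic H(↓). -/
theorem hsat_foldr {A W : Type} (R : W → W → Prop) (V : A → Set W) (Vp : Set W)
    (g : ℕ → W) (w : W) (S : List ℕ) :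
    HSat R V Vp (S.foldr (fun i acc => hdisj (.nom i) acc) .poison) g w ↔
      (w ∈ Vp ∨ ∃ i ∈ S, w = g i) := by
  induction S with
  | nil => simp [HSat]
  | cons a S ih =>
    simp only [hdisj] at ih
    simp only [List.foldr_cons, hdisj, HSat, ih, List.mem_cons, exists_eq_or_imp]
    clear ih
    generalize (∃ i ∈ S, w = g i) = Q
    by_cases h1 : w = g a <;> by_cases h2 : w ∈ Vp <;> simp [h1, h2]

theorem sat_iff_hsat {A W : Type} (R : W → W → Prop) (V : A → Set W) (Vp : Set W)
    (φ : PForm A) : ∀ (S : List ℕ) (c : ℕ) (g : ℕ → W) (w : W), (∀ i ∈ S, i < c) →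
    (Sat R V φ {v | v ∈ Vp ∨ ∃ i ∈ S, v = g i} w ↔ HSat R V Vp (HT φ S c) g w) := by
  induction φ with
  | atom a => intros; rfl
  | poison => intro S c g w _; exact (hsat_foldr R V Vp g w S).symm
  | neg φ ih => intro S c g w h; exact not_congr (ih S c g w h)
  | conj φ ψ ih1 ih2 => intro S c g w h; exact and_congr (ih1 S c g w h) (ih2 S c g w h)
  | dia φ ih =>
    intro S c g w h
    exact exists_congr fun v => and_congr Iff.rfl (ih S c g v h)
  | pdia φ ih =>
    intro S c g w h
    refine exists_congr fun v => and_congr Iff.rfl ?_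
    have h' : ∀ i ∈ c :: S, i < c + 1 := by
      intro i hi
      rcases List.mem_cons.1 hi with rfl | hi
      · omega
      · have := h i hi
        omega
    refine Iff.trans (Eq.to_iff ?_) (ih (c :: S) (c + 1) (Function.update g c v) v h')
    congr 1
    ext u
    have e : (∃ i ∈ S, u = Function.update g c v i) ↔ ∃ i ∈ S, u = g i := by
      refine exists_congr fun i => and_congr_right fun hi => ?_
      rw [Function.update_of_ne (h i hi).ne]
    simp only [Set.mem_insert_iff, Set.mem_setOf_eq, List.mem_cons, exists_eq_or_imp, e,
      Function.update_self]
    tauto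

/-- Proposition 4: for the hybrid extension `M_H` of a Kripke
model `M = (W,R,V)` (poison valuation `Vp`), any assignment `g`, any world `w`,
and any poison modal formula `φ`:  `(M,w) ⊨ φ` in poison semantics iff
`(M_H, g, w) ⊨_H HT^∅(φ)` in the hybrid logic `H(↓)` (for any choice `c` of
the fresh-variable counter used by the translation). -/
theorem stmt_19 {A W : Type} (R : W → W → Prop) (V : A → Set W) (Vp : Set W)
    (g : ℕ → W) (w : W) (φ : PForm A) (c : ℕ) :
    Sat R V φ Vp w ↔ HSat R V Vp (HT φ [] c) g w := by
  have h := sat_iff_hsat R V Vp φ [] c g w (by simp)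
  simpa using h
end
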